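/- arXiv:2204.02015 — 3 statements merged into one kernel-verified Lean document; each statement's English description precedes it below -/
import Mathlib

section
/- (Lemma 2.5, second inequality: ψ-fractional Poincaré–Friedrichs inequality for the right derivative.) There exists a constant C > 0, depending only on δ, ψ and Λ, such that for every v ∈ C_c^∞(Λ) one has ||v||_{L²_ψ(Λ)} ≤ C ||_tD^{δ,ψ} v||_{L²_ψ(Λ)}. -/
open MeasureTheory Real

/-- Right ψ-fractional integral on `Λ = (a,b)`. -/
noncomputable def rightPsiI (ψ : ℝ → ℝ) (b μ : ℝ) (v : ℝ → ℝ) (t : ℝ) : ℝ :=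
  (1 / Real.Gamma μ) * ∫ z in t..b, deriv ψ z * (ψ z - ψ t) ^ (μ - 1) * v z

/-- Right ψ-Riemann–Liouville derivative on `Λ = (a,b)`:
`_tD^{μ,ψ} v(t) = -(1/ψ'(t)) d/dt [_tI^{1-μ,ψ} v(t)]`. -/
noncomputable def rightPsiD (ψ : ℝ → ℝ) (b μ : ℝ) (v : ℝ → ℝ) (t : ℝ) : ℝ :=
  -(1 / deriv ψ t) * deriv (fun τ => rightPsiI ψ b (1 - μ) v τ) t

/-- The weighted `L²_ψ(Λ)` norm. -/
noncomputable def psiNorm (ψ : ℝ → ℝ) (a b : ℝ) (v : ℝ → ℝ) : ℝ :=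
  Real.sqrt (∫ t in a..b, (v t) ^ 2 * deriv ψ t)

open scoped Convolution

/-- The reflected power kernel `(-t) ^ (μ - 1)`, truncated to `(-L, 0)`. -/
noncomputable def reflectedPowerKernel (L μ t : ℝ) : ℝ :=
  Set.indicator (Set.Ioo (-L) 0) (fun t => (-t) ^ (μ - 1)) t

theorem reflectedPowerKernel_nonneg (L μ t : ℝ) : 0 ≤ reflectedPowerKernel L μ t :=
  Set.indicator_nonneg (fun _ ht => rpow_nonneg (by linarith [ht.2]) _) t

theorem reflectedPowerKernel_of_mem {L μ t : ℝ} (ht : t ∈ Set.Ioo (-L) 0) :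
    reflectedPowerKernel L μ t = (-t) ^ (μ - 1) :=
  Set.indicator_of_mem ht _

theorem reflectedPowerKernel_of_nonneg {L μ t : ℝ} (ht : 0 ≤ t) :
    reflectedPowerKernel L μ t = 0 :=
  Set.indicator_of_notMem (fun h => by linarith [h.2]) _

theorem integrable_reflectedPowerKernel {L μ : ℝ} (hL : 0 ≤ L) (hμ : 0 < μ) :
    Integrable (reflectedPowerKernel L μ) := by
  have h : IntervalIntegrable (fun t : ℝ => t ^ (μ - 1)) volume 0 L :=
    intervalIntegral.intervalIntegrable_rpow' (by linarith)
  have h2 := ((IntervalIntegrable.iff_comp_neg).mp h).symm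
  rw [neg_zero, intervalIntegrable_iff_integrableOn_Ioo_of_le (by linarith)] at h2
  exact h2.integrable_indicator measurableSet_Ioo

theorem integral_rpow_mul_sub_rpow {μ ν T : ℝ} (hμ : 0 < μ) (hν : 0 < ν) (hμν : μ + ν = 1)
    (hT : 0 < T) :
    ∫ x in (0 : ℝ)..T, x ^ (μ - 1) * (T - x) ^ (ν - 1) = ProbabilityTheory.beta μ ν := by
  have h := Complex.betaIntegral_scaled (μ : ℂ) (ν : ℂ) hT
  have e : (μ : ℂ) + ν - 1 = 0 := by rw [← Complex.ofReal_add, hμν]; simp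
  rw [e, Complex.cpow_zero, one_mul] at h
  rw [ProbabilityTheory.beta_eq_betaIntegralReal μ ν hμ hν, ← h]
  have e2 : ∫ x in (0 : ℝ)..T, (x : ℂ) ^ ((μ : ℂ) - 1) * ((T : ℂ) - x) ^ ((ν : ℂ) - 1)
      = ((∫ x in (0 : ℝ)..T, x ^ (μ - 1) * (T - x) ^ (ν - 1) : ℝ) : ℂ) := by
    rw [← intervalIntegral.integral_ofReal]
    refine intervalIntegral.integral_congr fun x hx => ?_
    rw [Set.uIcc_of_le hT.le] at hx
    rw [Complex.ofReal_mul, Complex.ofReal_cpow hx.1,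
      Complex.ofReal_cpow (by linarith [hx.2] : 0 ≤ T - x)]
    push_cast
    rfl
  rw [e2, Complex.ofReal_re]

theorem convolution_reflectedPowerKernel_of_mem {L μ ν t : ℝ} (hμ : 0 < μ) (hν : 0 < ν)
    (hμν : μ + ν = 1) (ht : t ∈ Set.Ioo (-L) 0) :
    (reflectedPowerKernel L μ ⋆[ContinuousLinearMap.mul ℝ ℝ] reflectedPowerKernel L ν) t
      = ProbabilityTheory.beta μ ν := by
  obtain ⟨h1, h2⟩ := ht
  have e : ∀ s, reflectedPowerKernel L μ s * reflectedPowerKernel L ν (t - s)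
      = Set.indicator (Set.Ioo t 0) (fun s => (-s) ^ (μ - 1) * (-t - -s) ^ (ν - 1)) s := by
    intro s
    by_cases hs : s ∈ Set.Ioo t 0
    · rw [Set.indicator_of_mem hs, reflectedPowerKernel_of_mem ⟨by linarith [hs.1], hs.2⟩,
        reflectedPowerKernel_of_mem ⟨by linarith [hs.2], by linarith [hs.1]⟩]
      congr 2
      ring
    · rw [Set.indicator_of_notMem hs]
      by_cases h0 : 0 ≤ s
      · rw [reflectedPowerKernel_of_nonneg h0, zero_mul]
      · have : s ≤ t := by
          by_contra hc
          exact hs ⟨not_le.mp hc, not_le.mp h0⟩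
        rw [reflectedPowerKernel_of_nonneg (sub_nonneg.mpr this), mul_zero]
  rw [convolution_def]
  simp only [ContinuousLinearMap.mul_apply', e]
  rw [integral_indicator measurableSet_Ioo, ← integral_Ioc_eq_integral_Ioo,
    ← intervalIntegral.integral_of_le h2.le,
    intervalIntegral.integral_comp_neg (fun s => s ^ (μ - 1) * (-t - s) ^ (ν - 1)), neg_zero]
  exact integral_rpow_mul_sub_rpow hμ hν hμν (by linarith)

theorem convolution_reflectedPowerKernel_of_nonneg {L μ ν t : ℝ} (ht : 0 ≤ t) :
    (reflectedPowerKernel L μ ⋆[ContinuousLinearMap.mul ℝ ℝ] reflectedPowerKernel L ν) t = 0 := by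
  rw [convolution_def]
  refine integral_eq_zero_of_ae (Filter.Eventually.of_forall fun s => ?_)
  simp only [ContinuousLinearMap.mul_apply', Pi.zero_apply]
  rcases le_total 0 s with hs | hs
  · rw [reflectedPowerKernel_of_nonneg hs, zero_mul]
  · rw [reflectedPowerKernel_of_nonneg (t := t - s) (by linarith), mul_zero]

/-- Jensen's inequality for convolution with a nonnegative integrable kernel. -/
theorem sq_convolution_le {h g : ℝ → ℝ} {M : ℝ} (h0 : ∀ t, 0 ≤ h t) (hh : Integrable h)
    (hg : Measurable g) (hM : ∀ t, |g t| ≤ M) (x : ℝ) :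
    ((h ⋆[ContinuousLinearMap.mul ℝ ℝ] g) x) ^ 2
      ≤ (∫ t, h t) * (h ⋆[ContinuousLinearMap.mul ℝ ℝ] fun t => g t ^ 2) x := by
  simp only [convolution_def, ContinuousLinearMap.mul_apply']
  have hgx : Measurable fun t => g (x - t) := hg.comp (measurable_const.sub measurable_id)
  have i1 : Integrable fun t => h t * g (x - t) :=
    hh.mul_bdd (c := M) hgx.aestronglyMeasurable (Filter.Eventually.of_forall fun t => hM _)
  have i2 : Integrable fun t => h t * g (x - t) ^ 2 :=
    hh.mul_bdd (c := M ^ 2) (hgx.pow_const 2).aestronglyMeasurable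
      (Filter.Eventually.of_forall fun t => by
        rw [Real.norm_eq_abs, abs_pow]
        exact pow_le_pow_left₀ (abs_nonneg _) (hM _) 2)
  have key : ∀ m : ℝ, 0 ≤ (∫ t, h t) * (m * m) + (-2 * ∫ t, h t * g (x - t)) * m
      + ∫ t, h t * g (x - t) ^ 2 := by
    intro m
    have e : ∫ t, h t * (g (x - t) - m) ^ 2 = (∫ t, h t) * (m * m)
        + (-2 * ∫ t, h t * g (x - t)) * m + ∫ t, h t * g (x - t) ^ 2 := by
      have i3 : Integrable fun t => h t * (m * m) := hh.mul_const _
      have i4 : Integrable fun t => -2 * (h t * g (x - t)) * m := (i1.const_mul _).mul_const _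
      have i5 : Integrable fun t => h t * (m * m) + -2 * (h t * g (x - t)) * m := i3.add i4
      rw [← integral_mul_const, ← integral_const_mul, ← integral_mul_const,
        ← integral_add i3 i4, ← integral_add i5 i2]
      congr 1
      ext t
      ring
    rw [← e]
    exact integral_nonneg fun t => mul_nonneg (h0 t) (sq_nonneg _)
  have := discrim_le_zero key
  rw [discrim] at this
  nlinarith

/-- The right fractional integral inverts the right fractional derivative, up to a constant. -/
theorem convolution_reflectedPowerKernel_inversion {μ ν A B x : ℝ} (hμ : 0 < μ) (hν : 0 < ν)
    (hμν : μ + ν = 1) {w : ℝ → ℝ} (hw : ContDiff ℝ 1 w) (hws : tsupport w ⊆ Set.Ioo A B)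
    (hwc : HasCompactSupport w) (hx : x ∈ Set.Ioo A B) :
    (reflectedPowerKernel (B - A) μ ⋆[ContinuousLinearMap.mul ℝ ℝ]
      (reflectedPowerKernel (B - A) ν ⋆[ContinuousLinearMap.mul ℝ ℝ] deriv w)) x
      = -(ProbabilityTheory.beta μ ν * w x) := by
  have hL : 0 ≤ B - A := by linarith [hx.1, hx.2]
  have iμ := integrable_reflectedPowerKernel hL hμ
  have iν := integrable_reflectedPowerKernel hL hν
  have hdc : Continuous (deriv w) := hw.continuous_deriv le_rfl
  have hds : HasCompactSupport (deriv w) := hwc.deriv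
  have idw : Integrable (deriv w) := hdc.integrable_of_hasCompactSupport hds
  rw [← convolution_assoc (ContinuousLinearMap.mul ℝ ℝ) (ContinuousLinearMap.mul ℝ ℝ)
    (ContinuousLinearMap.mul ℝ ℝ) (ContinuousLinearMap.mul ℝ ℝ) (fun a b c => by
      simp only [ContinuousLinearMap.mul_apply']; ring)
    iμ.aestronglyMeasurable iν.aestronglyMeasurable idw.aestronglyMeasurable
    (iμ.ae_convolution_exists _ iν) (iν.norm.ae_convolution_exists _ idw.norm) ?_]
  · rw [convolution_eq_swap]
    have e : ∀ y, ContinuousLinearMap.mul ℝ ℝ ((reflectedPowerKernel (B - A) μ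
        ⋆[ContinuousLinearMap.mul ℝ ℝ] reflectedPowerKernel (B - A) ν) (x - y)) (deriv w y)
        = Set.indicator (Set.Ioc x B) (fun y => ProbabilityTheory.beta μ ν * deriv w y) y := by
      intro y
      rw [ContinuousLinearMap.mul_apply']
      by_cases hy : y ∈ tsupport w
      · have hyAB := hws hy
        rcases le_or_gt y x with hyx | hyx
        · rw [convolution_reflectedPowerKernel_of_nonneg (sub_nonneg.mpr hyx),
            Set.indicator_of_notMem (fun h => by linarith [(Set.mem_Ioc.mp h).1]), zero_mul]
        · rw [convolution_reflectedPowerKernel_of_mem hμ hν hμν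
            ⟨by linarith [hyAB.2, hx.1], by linarith⟩,
            Set.indicator_of_mem (Set.mem_Ioc.mpr ⟨hyx, hyAB.2.le⟩)]
      · have : deriv w y = 0 := by
          by_contra hne
          exact hy (support_deriv_subset hne)
        simp [Set.indicator, this]
    simp only [e]
    rw [integral_indicator measurableSet_Ioc, ← intervalIntegral.integral_of_le hx.2.le,
      intervalIntegral.integral_const_mul, intervalIntegral.integral_deriv_eq_sub
        (fun y _ => (hw.differentiable one_ne_zero) y) (hdc.intervalIntegrable _ _)]
    have : w B = 0 := image_eq_zero_of_notMem_tsupport fun h => lt_irrefl _ (hws h).2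
    rw [this]
    ring
  · have hc : Continuous ((fun y => ‖reflectedPowerKernel (B - A) ν y‖)
        ⋆[ContinuousLinearMap.mul ℝ ℝ] fun y => ‖deriv w y‖) :=
      hds.norm.continuous_convolution_right _ iν.norm.locallyIntegrable hdc.norm
    have hi : IntegrableOn (reflectedPowerKernel (B - A) μ) (Set.Icc (-(B - A)) 0) :=
      iμ.integrableOn
    have := IntegrableOn.mul_continuousOn hi.norm
      (hc.comp (continuous_const.sub continuous_id : Continuous fun t => x - t)).continuousOn
      isCompact_Icc
    refine (integrableOn_iff_integrable_of_support_subset fun t ht => ?_).mp this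
    by_contra hn
    refine ht ?_
    have : reflectedPowerKernel (B - A) μ t = 0 :=
      Set.indicator_of_notMem (fun h => hn ⟨h.1.le, h.2.le⟩) _
    simp [this]

theorem exists_integral_sq_le_integral_sq_convolution {δ A B : ℝ} (hδ0 : 0 < δ) (hδ1 : δ < 1)
    (hAB : A < B) :
    ∃ K : ℝ, 0 ≤ K ∧ ∀ w : ℝ → ℝ, ContDiff ℝ 1 w → HasCompactSupport w →
      tsupport w ⊆ Set.Ioo A B →
      ∫ x in A..B, w x ^ 2 ≤ K * ∫ x in A..B, ((reflectedPowerKernel (B - A) (1 - δ)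
        ⋆[ContinuousLinearMap.mul ℝ ℝ] deriv w) x) ^ 2 := by
  set h := reflectedPowerKernel (B - A) δ with hh
  set c := ProbabilityTheory.beta δ (1 - δ) with hc
  have hcpos : 0 < c := ProbabilityTheory.beta_pos hδ0 (by linarith)
  have hi : Integrable h := integrable_reflectedPowerKernel (by linarith) hδ0
  have h0 : ∀ t, 0 ≤ h t := reflectedPowerKernel_nonneg _ _
  refine ⟨((∫ t, h t) / c) ^ 2, sq_nonneg _, fun w hw hwc hws => ?_⟩
  set G := reflectedPowerKernel (B - A) (1 - δ) ⋆[ContinuousLinearMap.mul ℝ ℝ] deriv w with hG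
  have hGc : Continuous G := hwc.deriv.continuous_convolution_right _
    (integrable_reflectedPowerKernel (by linarith) (by linarith)).locallyIntegrable
    (hw.continuous_deriv le_rfl)
  obtain ⟨M, hM⟩ := (isCompact_Icc (a := A) (b := B)).exists_bound_of_continuousOn hGc.continuousOn
  set g := Set.indicator (Set.Ioo A B) G with hg
  have hgm : Measurable g := hGc.measurable.indicator measurableSet_Ioo
  have hgM : ∀ t, |g t| ≤ |M| := by
    intro t
    by_cases ht : t ∈ Set.Ioo A B
    · rw [hg, Set.indicator_of_mem ht]
      exact (hM t ⟨ht.1.le, ht.2.le⟩).trans (le_abs_self M)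
    · rw [hg, Set.indicator_of_notMem ht, abs_zero]
      exact abs_nonneg M
  have eg2 : (fun t => g t ^ 2) = Set.indicator (Set.Ioo A B) fun t => G t ^ 2 := by
    ext t
    by_cases ht : t ∈ Set.Ioo A B <;> simp [hg, ht]
  have ig2 : Integrable fun t => g t ^ 2 := by
    rw [eg2]
    exact (((hGc.pow 2).continuousOn.integrableOn_Icc).mono_set
      Set.Ioo_subset_Icc_self).integrable_indicator measurableSet_Ioo
  have hrep : ∀ x ∈ Set.Ioo A B, w x ^ 2
      ≤ (∫ t, h t) / c ^ 2 * (h ⋆[ContinuousLinearMap.mul ℝ ℝ] fun t => g t ^ 2) x := by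
    intro x hx
    have e : (h ⋆[ContinuousLinearMap.mul ℝ ℝ] g) x = -(c * w x) := by
      rw [← convolution_reflectedPowerKernel_inversion hδ0 (by linarith : 0 < 1 - δ) (by ring)
        hw hws hwc hx, convolution_eq_swap, convolution_eq_swap]
      congr 1
      ext y
      simp only [ContinuousLinearMap.mul_apply']
      rcases le_or_gt y x with hyx | hyx
      · rw [reflectedPowerKernel_of_nonneg (sub_nonneg.mpr hyx), hh,
          reflectedPowerKernel_of_nonneg (sub_nonneg.mpr hyx), zero_mul, zero_mul]
      · rcases lt_or_ge y B with hyB | hyB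
        · rw [hg, Set.indicator_of_mem (Set.mem_Ioo.mpr ⟨hx.1.trans hyx, hyB⟩)]
        · have hGy : G y = 0 := by
            rw [hG, convolution_eq_swap]
            refine integral_eq_zero_of_ae (Filter.Eventually.of_forall fun z => ?_)
            simp only [ContinuousLinearMap.mul_apply', Pi.zero_apply]
            by_cases hz : z ∈ tsupport w
            · rw [reflectedPowerKernel_of_nonneg (by linarith [(hws hz).2]), zero_mul]
            · have : deriv w z = 0 := by
                by_contra hne
                exact hz (support_deriv_subset hne)
              rw [this, mul_zero]
          rw [hg, Set.indicator_of_notMem (fun h => by linarith [(Set.mem_Ioo.mp h).2]), ← hG, hGy]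
    have hsq := sq_convolution_le h0 hi hgm hgM x
    rw [e] at hsq
    rw [div_mul_eq_mul_div, le_div_iff₀ (by positivity)]
    linarith [hsq, (by ring : (-(c * w x)) ^ 2 = w x ^ 2 * c ^ 2)]
  have iconv : Integrable (h ⋆[ContinuousLinearMap.mul ℝ ℝ] fun t => g t ^ 2) :=
    hi.integrable_convolution _ ig2
  have hconv0 : ∀ x, 0 ≤ (h ⋆[ContinuousLinearMap.mul ℝ ℝ] fun t => g t ^ 2) x := fun x =>
    integral_nonneg fun t => mul_nonneg (h0 t) (sq_nonneg _)
  have hH : 0 ≤ ∫ t, h t := integral_nonneg h0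
  rw [intervalIntegral.integral_of_le hAB.le, intervalIntegral.integral_of_le hAB.le,
    integral_Ioc_eq_integral_Ioo, integral_Ioc_eq_integral_Ioo]
  calc ∫ x in Set.Ioo A B, w x ^ 2
      ≤ ∫ x in Set.Ioo A B, (∫ t, h t) / c ^ 2
          * (h ⋆[ContinuousLinearMap.mul ℝ ℝ] fun t => g t ^ 2) x :=
        setIntegral_mono_on
          (((hw.continuous.pow 2).continuousOn.integrableOn_Icc).mono_set
            Set.Ioo_subset_Icc_self)
          (iconv.const_mul _).integrableOn measurableSet_Ioo hrep
    _ ≤ ∫ x, (∫ t, h t) / c ^ 2 * (h ⋆[ContinuousLinearMap.mul ℝ ℝ] fun t => g t ^ 2) x :=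
        setIntegral_le_integral (iconv.const_mul _) (Filter.Eventually.of_forall fun x =>
          mul_nonneg (by positivity) (hconv0 x))
    _ = ((∫ t, h t) / c) ^ 2 * ∫ x in Set.Ioo A B, G x ^ 2 := by
        rw [integral_const_mul, integral_convolution _ hi ig2, eg2,
          integral_indicator measurableSet_Ioo, ContinuousLinearMap.mul_apply']
        ring

/-- Change of variables turns the right `ψ`-fractional integral into a convolution. -/
theorem rightPsiI_eq_convolution {ψ v w : ℝ → ℝ} {a b μ τ : ℝ} (hψ : Differentiable ℝ ψ)
    (hmono : StrictMono ψ) (hsurj : Function.Surjective ψ) (hψ' : ∀ t, 0 < deriv ψ t)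
    (hwv : ∀ t, w (ψ t) = v t) (hws : Function.support w ⊆ Set.Ioo (ψ a) (ψ b))
    (hτ : τ ∈ Set.Ioo a b) :
    rightPsiI ψ b μ v τ = 1 / Real.Gamma μ *
      (reflectedPowerKernel (ψ b - ψ a) μ ⋆[ContinuousLinearMap.mul ℝ ℝ] w) (ψ τ) := by
  have himg : ψ '' Set.Ioc τ b = Set.Ioc (ψ τ) (ψ b) :=
    (StrictMono.orderIsoOfSurjective ψ hmono hsurj).image_Ioc τ b
  rw [rightPsiI, convolution_eq_swap, intervalIntegral.integral_of_le hτ.2.le]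
  congr 1
  have e : ∀ y, ContinuousLinearMap.mul ℝ ℝ
      (reflectedPowerKernel (ψ b - ψ a) μ (ψ τ - y)) (w y)
      = Set.indicator (Set.Ioc (ψ τ) (ψ b)) (fun y => (y - ψ τ) ^ (μ - 1) * w y) y := by
    intro y
    rw [ContinuousLinearMap.mul_apply']
    by_cases hy : w y = 0
    · simp [Set.indicator, hy]
    · have hyAB := hws hy
      have := hmono hτ.1
      rcases le_or_gt y (ψ τ) with hyx | hyx
      · rw [reflectedPowerKernel_of_nonneg (sub_nonneg.mpr hyx),
          Set.indicator_of_notMem (fun h => by linarith [(Set.mem_Ioc.mp h).1]), zero_mul]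
      · rw [reflectedPowerKernel_of_mem ⟨by linarith [hyAB.2], by linarith⟩,
          Set.indicator_of_mem (Set.mem_Ioc.mpr ⟨hyx, hyAB.2.le⟩), neg_sub]
  simp only [e]
  rw [integral_indicator measurableSet_Ioc, ← himg,
    integral_image_eq_integral_abs_deriv_smul measurableSet_Ioc
      (fun x _ => (hψ x).hasDerivAt.hasDerivWithinAt) hmono.injective.injOn]
  congr 1
  ext z
  rw [abs_of_pos (hψ' z), hwv, smul_eq_mul, mul_assoc]

theorem rightPsiD_eq_convolution {ψ v w : ℝ → ℝ} {a b δ t : ℝ} (hδ1 : δ < 1)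
    (hψ : Differentiable ℝ ψ)
    (hmono : StrictMono ψ) (hsurj : Function.Surjective ψ) (hψ' : ∀ t, 0 < deriv ψ t)
    (hw : ContDiff ℝ 1 w) (hwc : HasCompactSupport w)
    (hwv : ∀ t, w (ψ t) = v t) (hws : Function.support w ⊆ Set.Ioo (ψ a) (ψ b))
    (ht : t ∈ Set.Ioo a b) :
    rightPsiD ψ b δ v t = -(1 / Real.Gamma (1 - δ)) *
      (reflectedPowerKernel (ψ b - ψ a) (1 - δ) ⋆[ContinuousLinearMap.mul ℝ ℝ] deriv w) (ψ t) := by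
  have hab : ψ a ≤ ψ b := (hmono (ht.1.trans ht.2)).le
  have hev : (fun τ => rightPsiI ψ b (1 - δ) v τ) =ᶠ[nhds t] fun τ =>
      1 / Real.Gamma (1 - δ) * (reflectedPowerKernel (ψ b - ψ a) (1 - δ)
        ⋆[ContinuousLinearMap.mul ℝ ℝ] w) (ψ τ) := by
    filter_upwards [isOpen_Ioo.mem_nhds ht] with τ hτ
    exact rightPsiI_eq_convolution hψ hmono hsurj hψ' hwv hws hτ
  have hd := ((hwc.hasDerivAt_convolution_right (ContinuousLinearMap.mul ℝ ℝ)
    (integrable_reflectedPowerKernel (sub_nonneg.mpr hab)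
      (sub_pos.mpr hδ1)).locallyIntegrable hw (ψ t)).comp t
    (hψ t).hasDerivAt).const_mul (1 / Real.Gamma (1 - δ))
  rw [rightPsiD, hev.deriv_eq]
  erw [hd.deriv]
  have := (hψ' t).ne'
  field_simp

/-- The weighted norm is the unweighted norm after the change of variables `x = ψ t`. -/
theorem psiNorm_eq_sqrt_integral {ψ v w : ℝ → ℝ} {a b : ℝ} (hψ : ContDiff ℝ 1 ψ)
    (hab : a < b) (hw : Continuous w) (hwv : ∀ t ∈ Set.Ioo a b, w (ψ t) = v t) :
    psiNorm ψ a b v = Real.sqrt (∫ x in ψ a..ψ b, w x ^ 2) := by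
  rw [psiNorm, ← intervalIntegral.integral_comp_mul_deriv (f := ψ) (f' := deriv ψ)
    (g := fun x => w x ^ 2)
    (fun x _ => (hψ.differentiable one_ne_zero x).hasDerivAt)
    (hψ.continuous_deriv le_rfl).continuousOn (hw.pow 2)]
  congr 1
  rw [intervalIntegral.integral_of_le hab.le, intervalIntegral.integral_of_le hab.le,
    integral_Ioc_eq_integral_Ioo, integral_Ioc_eq_integral_Ioo]
  refine setIntegral_congr_fun measurableSet_Ioo fun t ht => ?_
  change v t ^ 2 * deriv ψ t = w (ψ t) ^ 2 * deriv ψ t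
  rw [hwv t ht]

/-- ψ-fractional Poincaré–Friedrichs inequality for the right derivative. -/
theorem psi_poincare_friedrichs_right
    (δ : ℝ) (hδ0 : 0 < δ) (hδ1 : δ < 1)
    (ψ : ℝ → ℝ) (hψ : ContDiff ℝ 1 ψ) (hmono : StrictMono ψ)
    (hbij : Function.Bijective ψ) (hψ' : ∀ t, 0 < deriv ψ t)
    (a b : ℝ) (hab : a < b) :
    ∃ C : ℝ, 0 < C ∧ ∀ v : ℝ → ℝ,
      ContDiff ℝ (⊤ : ℕ∞) v → HasCompactSupport v → tsupport v ⊆ Set.Ioo a b →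
      psiNorm ψ a b v ≤ C * psiNorm ψ a b (rightPsiD ψ b δ v) := by
  have hA : ψ a < ψ b := hmono hab
  have hdiff : Differentiable ℝ ψ := hψ.differentiable one_ne_zero
  obtain ⟨K, hK, hmain⟩ := exists_integral_sq_le_integral_sq_convolution hδ0 hδ1 hA
  have hΓ : 0 < Real.Gamma (1 - δ) := Real.Gamma_pos_of_pos (by linarith)
  refine ⟨Real.sqrt K * Real.Gamma (1 - δ) + 1, by positivity, fun v hv hvc hvs => ?_⟩
  let e : ℝ ≃ₜ ℝ := (StrictMono.orderIsoOfSurjective ψ hmono hbij.2).toHomeomorph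
  have heψ : ∀ t, e.symm (ψ t) = t := fun t => e.symm_apply_apply t
  have hφ : ContDiff ℝ 1 e.symm :=
    e.contDiff_symm_deriv (fun x => (hψ' x).ne') (fun x => (hdiff x).hasDerivAt) hψ
  have hw : ContDiff ℝ 1 (v ∘ e.symm) := (hv.of_le (by exact_mod_cast le_top)).comp hφ
  have hwc : HasCompactSupport (v ∘ e.symm) := hvc.comp_homeomorph e.symm
  have hwv : ∀ t, (v ∘ e.symm) (ψ t) = v t := fun t => congrArg v (heψ t)
  have hws : tsupport (v ∘ e.symm) ⊆ Set.Ioo (ψ a) (ψ b) := by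
    intro y hy
    have hy' := hvs (tsupport_comp_subset_preimage v e.symm.continuous hy)
    obtain ⟨t, rfl⟩ := hbij.2 y
    rw [heψ] at hy'
    exact ⟨hmono hy'.1, hmono hy'.2⟩
  have hGc := hwc.deriv.continuous_convolution_right (ContinuousLinearMap.mul ℝ ℝ)
    (integrable_reflectedPowerKernel (sub_nonneg.mpr hA.le) (sub_pos.mpr hδ1)).locallyIntegrable
    (hw.continuous_deriv le_rfl)
  rw [psiNorm_eq_sqrt_integral hψ hab hw.continuous fun t _ => hwv t,
    psiNorm_eq_sqrt_integral hψ hab (continuous_const.mul hGc) fun t ht =>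
      (rightPsiD_eq_convolution hδ1 hdiff hmono hbij.2 hψ' hw hwc hwv
        ((subset_tsupport _).trans hws) ht).symm]
  simp only [Pi.mul_apply, mul_pow, intervalIntegral.integral_const_mul]
  rw [Real.sqrt_mul (sq_nonneg _), Real.sqrt_sq_eq_abs, abs_neg, abs_of_pos (by positivity)]
  refine (Real.sqrt_le_sqrt (hmain _ hw hwc hws)).trans ?_
  rw [Real.sqrt_mul hK, add_mul, one_mul]
  refine le_add_of_le_of_nonneg (le_of_eq ?_) (by positivity)
  field_simp
end

section
/- (Equation (2.21): splitting of the ψ-fractional derivative of order δ into two derivatives of order δ/2.) For all v, w ∈ C_c^∞(Λ), (D^{δ,ψ}_t v, w)_{L²_ψ(Λ)} = (D^{δ/2,ψ}_t v, _tD^{δ/2,ψ} w)_{L²_ψ(Λ)}, i.e. ∫_{a_ψ}^{b_ψ} (D^{δ,ψ}_t v)(t) w(t) ψ'(t) dt = ∫_{a_ψ}^{b_ψ} (D^{δ/2,ψ}_t v)(t) (_tD^{δ/2,ψ} w)(t) ψ'(t) dt. -/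
open MeasureTheory Real

/-- Left ψ-fractional integral on `Λ = (a,b)`. -/
noncomputable def leftPsiI (ψ : ℝ → ℝ) (a μ : ℝ) (v : ℝ → ℝ) (t : ℝ) : ℝ :=
  (1 / Real.Gamma μ) * ∫ z in a..t, deriv ψ z * (ψ t - ψ z) ^ (μ - 1) * v z

/-- Left ψ-Riemann–Liouville derivative on `Λ = (a,b)`. -/
noncomputable def leftPsiD (ψ : ℝ → ℝ) (a μ : ℝ) (v : ℝ → ℝ) (t : ℝ) : ℝ :=
  (1 / deriv ψ t) * deriv (fun τ => leftPsiI ψ a (1 - μ) v τ) t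

/-- The Riemann–Liouville kernel `s ↦ s ^ (μ - 1) / Γ(μ)`, truncated to `(0, T)`. -/
noncomputable def rlKernel (T μ : ℝ) : ℝ → ℝ :=
  (Set.Ioo 0 T).indicator fun s => (1 / Real.Gamma μ) * s ^ (μ - 1)

lemma rlKernel_of_mem {T μ s : ℝ} (hs : s ∈ Set.Ioo 0 T) :
    rlKernel T μ s = (1 / Real.Gamma μ) * s ^ (μ - 1) :=
  Set.indicator_of_mem hs _

lemma rlKernel_of_nonpos {T μ s : ℝ} (hs : s ≤ 0) : rlKernel T μ s = 0 :=
  Set.indicator_of_notMem (fun h => h.1.not_ge hs) _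

lemma integrable_rlKernel (T : ℝ) {μ : ℝ} (hμ : 0 < μ) : Integrable (rlKernel T μ) := by
  rw [rlKernel, integrable_indicator_iff measurableSet_Ioo]
  refine Integrable.const_mul ?_ _
  rcases le_or_gt T 0 with hT | hT
  · simp [Set.Ioo_eq_empty_of_le hT]
  · have h := intervalIntegral.intervalIntegrable_rpow' (a := 0) (b := T) (r := μ - 1) (by linarith)
    rw [intervalIntegrable_iff_integrableOn_Ioo_of_le hT.le] at h
    exact h

/-- Transposition of a convolution operator with integrable kernel. -/
lemma integral_mul_integral_kernel_comm {κ φ h : ℝ → ℝ} (hκ : Integrable κ) (hφ : Integrable φ)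
    (hh : Continuous h) {C : ℝ} (hC : ∀ z, ‖h z‖ ≤ C) :
    ∫ x, φ x * ∫ z, κ (z - x) * h z = ∫ z, h z * ∫ x, κ (z - x) * φ x := by
  have hint : Integrable (fun p : ℝ × ℝ => κ (p.1 - p.2) * φ p.2 * h p.1)
      (volume.prod volume) := by
    refine Integrable.mul_bdd (c := C) ?_
      (hh.comp continuous_fst).aestronglyMeasurable (.of_forall fun p => hC p.1)
    simpa [mul_comm] using hφ.convolution_integrand (ContinuousLinearMap.mul ℝ ℝ) hκ
  have := integral_integral_swap (f := fun z x => κ (z - x) * φ x * h z) hint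
  simp_rw [← integral_const_mul]
  calc _ = ∫ x, ∫ z, κ (z - x) * φ x * h z := by
        congr 1 with x; congr 1 with z; ring
    _ = ∫ z, ∫ x, κ (z - x) * φ x * h z := this.symm
    _ = _ := by congr 1 with x; congr 1 with z; ring

lemma integral_kernel_eq_convolution (κ V : ℝ → ℝ) (x : ℝ) :
    ∫ y, κ (x - y) * V y = convolution κ V (ContinuousLinearMap.mul ℝ ℝ) volume x := by
  rw [convolution, ← integral_sub_left_eq_self _ volume x]
  simp

lemma hasDerivAt_integral_kernel {κ V : ℝ → ℝ} (hκ : Integrable κ) (hV : ContDiff ℝ 1 V)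
    (hVc : HasCompactSupport V) (x : ℝ) :
    HasDerivAt (fun x => ∫ y, κ (x - y) * V y) (∫ y, κ (x - y) * deriv V y) x := by
  simp_rw [integral_kernel_eq_convolution]
  exact hVc.hasDerivAt_convolution_right _ hκ.locallyIntegrable hV x

lemma continuous_integral_kernel {κ g : ℝ → ℝ} (hκ : Integrable κ) (hg : Continuous g)
    (hgc : HasCompactSupport g) : Continuous fun x => ∫ y, κ (x - y) * g y := by
  simp_rw [integral_kernel_eq_convolution]
  exact hgc.continuous_convolution_right _ hκ.locallyIntegrable hg

lemma norm_integral_kernel_le {κ g : ℝ → ℝ} (hκ : Integrable κ) {C : ℝ} (hC : ∀ z, ‖g z‖ ≤ C)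
    (x : ℝ) : ‖∫ y, κ (x - y) * g y‖ ≤ (∫ y, ‖κ y‖) * C := by
  rw [← integral_sub_left_eq_self (fun y => ‖κ y‖) volume x, ← integral_mul_const]
  refine norm_integral_le_of_norm_le ((hκ.comp_sub_left x).norm.mul_const C) (.of_forall fun y => ?_)
  rw [norm_mul]
  exact mul_le_mul_of_nonneg_left (hC y) (norm_nonneg _)

lemma integral_rpow_mul_sub_rpow_s10 {μ ν s : ℝ} (hμ : 0 < μ) (hν : 0 < ν) (hs : 0 < s) :
    ∫ u in 0..s, u ^ (μ - 1) * (s - u) ^ (ν - 1) =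
      s ^ (μ + ν - 1) * (Real.Gamma μ * Real.Gamma ν / Real.Gamma (μ + ν)) := by
  have h1 := Complex.betaIntegral_scaled μ ν hs
  have h2 := Complex.Gamma_mul_Gamma_eq_betaIntegral (s := μ) (t := ν) (by simpa) (by simpa)
  have h3 : Complex.betaIntegral μ ν
      = ((Real.Gamma μ * Real.Gamma ν / Real.Gamma (μ + ν) : ℝ) : ℂ) := by
    have hne : ((Real.Gamma (μ + ν) : ℝ) : ℂ) ≠ 0 :=
      Complex.ofReal_ne_zero.mpr (Real.Gamma_pos_of_pos (by linarith)).ne'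
    rw [← Complex.ofReal_add, Complex.Gamma_ofReal, Complex.Gamma_ofReal, Complex.Gamma_ofReal] at h2
    push_cast
    rw [eq_div_iff hne, h2]
    ring
  rw [h3] at h1
  apply Complex.ofReal_injective
  rw [← intervalIntegral.integral_ofReal]
  push_cast [Complex.ofReal_cpow hs.le] at h1 ⊢
  rw [← h1]
  refine intervalIntegral.integral_congr fun u hu => ?_
  rw [Set.uIcc_of_le hs.le] at hu
  rw [Complex.ofReal_cpow hu.1, Complex.ofReal_cpow (by linarith [hu.2])]
  push_cast
  rfl

/-- Semigroup property of the Riemann–Liouville kernels. -/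
lemma integral_rlKernel_mul_rlKernel {T μ ν y z : ℝ} (hμ : 0 < μ) (hν : 0 < ν) (hyz : z - y < T) :
    ∫ x, rlKernel T ν (z - x) * rlKernel T μ (x - y) = rlKernel T (μ + ν) (z - y) := by
  rcases le_or_gt z y with h | h
  · rw [rlKernel_of_nonpos (by linarith)]
    refine (integral_congr_ae (.of_forall fun x => ?_)).trans (integral_zero _ _)
    rcases le_total z x with hx | hx
    · simp [rlKernel_of_nonpos (sub_nonpos.mpr hx)]
    · simp [rlKernel_of_nonpos (sub_nonpos.mpr (hx.trans h))]
  · rw [← integral_add_right_eq_self _ y,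
      ← setIntegral_eq_integral_of_forall_compl_eq_zero (s := Set.Ioo 0 (z - y))]
    · rw [rlKernel_of_mem ⟨by linarith, hyz⟩]
      have key := integral_rpow_mul_sub_rpow_s10 hμ hν (s := z - y) (by linarith)
      rw [intervalIntegral.integral_of_le (by linarith), integral_Ioc_eq_integral_Ioo] at key
      have hμ' := (Real.Gamma_pos_of_pos hμ).ne'
      have hν' := (Real.Gamma_pos_of_pos hν).ne'
      have hs' := (Real.Gamma_pos_of_pos (add_pos hμ hν)).ne'
      calc _ = ∫ u in Set.Ioo 0 (z - y), (1 / Real.Gamma ν * (1 / Real.Gamma μ)) *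
            (u ^ (μ - 1) * (z - y - u) ^ (ν - 1)) := by
            refine setIntegral_congr_fun measurableSet_Ioo fun u hu => ?_
            rw [rlKernel_of_mem ⟨by linarith [hu.2], by linarith [hu.1]⟩,
              rlKernel_of_mem ⟨by linarith [hu.1], by linarith [hu.2]⟩,
              show z - (u + y) = z - y - u by ring, show u + y - y = u by ring]
            ring
        _ = _ := by
            rw [integral_const_mul, key]
            field_simp
    · intro u hu
      rcases le_or_gt u 0 with h0 | h0
      · rw [rlKernel_of_nonpos (s := u + y - y) (by linarith), mul_zero]
      · have : z - y ≤ u := not_lt.mp fun h' => hu ⟨h0, h'⟩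
        rw [rlKernel_of_nonpos (s := z - (u + y)) (by linarith), zero_mul]

/-- Integration over the line against a kernel reduces to an interval when the function is
supported to the left of `b`. -/
lemma integral_rlKernel_right {b μ T y : ℝ} {g : ℝ → ℝ} (hy : b - y ≤ T)
    (hg : ∀ z, b ≤ z → g z = 0) :
    ∫ z, rlKernel T μ (z - y) * g z =
      ∫ z in Set.Ioo y b, (1 / Real.Gamma μ) * (z - y) ^ (μ - 1) * g z := by
  rw [← setIntegral_eq_integral_of_forall_compl_eq_zero (s := Set.Ioo y b)]
  · refine setIntegral_congr_fun measurableSet_Ioo fun z hz => ?_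
    rw [rlKernel_of_mem ⟨by linarith [hz.1], by linarith [hz.2]⟩]
  · intro z hz
    rcases le_or_gt z y with h | h
    · rw [rlKernel_of_nonpos (by linarith), zero_mul]
    · rw [hg z (not_lt.mp fun h' => hz ⟨h, h'⟩), mul_zero]

lemma integral_rlKernel_left {a μ T x : ℝ} {g : ℝ → ℝ} (hx : x - a ≤ T)
    (hg : ∀ z, z ≤ a → g z = 0) :
    ∫ y, rlKernel T μ (x - y) * g y =
      ∫ y in Set.Ioo a x, (1 / Real.Gamma μ) * (x - y) ^ (μ - 1) * g y := by
  rw [← setIntegral_eq_integral_of_forall_compl_eq_zero (s := Set.Ioo a x)]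
  · refine setIntegral_congr_fun measurableSet_Ioo fun z hz => ?_
    rw [rlKernel_of_mem ⟨by linarith [hz.2], by linarith [hz.1]⟩]
  · intro z hz
    rcases le_or_gt x z with h | h
    · rw [rlKernel_of_nonpos (by linarith), zero_mul]
    · rw [hg z (not_lt.mp fun h' => hz ⟨h', h⟩), mul_zero]

/-- Integration by parts for the right Riemann–Liouville operator. -/
lemma integral_rlKernel_mul_deriv {b μ T y : ℝ} {W : ℝ → ℝ} (hμ : 0 < μ) (hyb : y < b)
    (hy : b - y ≤ T) (hW : ContDiff ℝ 1 W) (hWs : tsupport W ⊆ Set.Iio b) :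
    ∫ z, rlKernel T (μ + 1) (z - y) * deriv W z = -∫ z, rlKernel T μ (z - y) * W z := by
  have hW0 : ∀ z, b ≤ z → W z = 0 := fun z hz =>
    image_eq_zero_of_notMem_tsupport fun h => (hWs h).not_ge hz
  have hW0' : ∀ z, b ≤ z → deriv W z = 0 := fun z hz =>
    deriv_of_notMem_tsupport fun h => (hWs h).not_ge hz
  rw [integral_rlKernel_right hy hW0', integral_rlKernel_right hy hW0]
  have hG := (Real.Gamma_pos_of_pos hμ).ne'
  have hΓ := Real.Gamma_add_one hμ.ne'
  have parts := intervalIntegral.integral_mul_deriv_eq_deriv_mul_of_hasDerivAt (a := y) (b := b)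
    (u := fun z => (z - y) ^ μ) (u' := fun z => μ * (z - y) ^ (μ - 1)) (v := W) (v' := deriv W)
    ((continuous_id.sub continuous_const).rpow_const fun _ => .inr hμ.le).continuousOn
    hW.continuous.continuousOn
    (fun z hz => by
      rw [min_eq_left hyb.le] at hz
      simpa using ((hasDerivAt_id z).sub_const y).rpow_const (p := μ)
        (.inl (sub_pos.mpr hz.1).ne'))
    (fun z _ => (hW.differentiable one_ne_zero z).hasDerivAt)
    (by
      refine IntervalIntegrable.const_mul ?_ _
      have := (intervalIntegral.intervalIntegrable_rpow' (a := 0) (b := b - y) (r := μ - 1)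
        (by linarith)).comp_sub_right y
      simpa using this)
    ((hW.continuous_deriv le_rfl).intervalIntegrable _ _)
  rw [hW0 b le_rfl, sub_self, Real.zero_rpow hμ.ne', intervalIntegral.integral_of_le hyb.le,
    intervalIntegral.integral_of_le hyb.le, integral_Ioc_eq_integral_Ioo,
    integral_Ioc_eq_integral_Ioo] at parts
  simp_rw [mul_assoc]
  rw [integral_const_mul, integral_const_mul, add_sub_cancel_right, parts, hΓ]
  simp_rw [mul_assoc]
  rw [integral_const_mul]
  field_simp
  ring

/-- The splitting identity on the line, for Riemann–Liouville operators with `ψ = id`. -/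
lemma integral_rlKernel_splitting {a b μ ν : ℝ} {V W : ℝ → ℝ} (hμ : 0 < μ) (hν : 0 < ν)
    (hμν : μ + μ = ν + 1)
    (hV : ContDiff ℝ 1 V) (hVc : HasCompactSupport V) (hVs : tsupport V ⊆ Set.Ioo a b)
    (hW : ContDiff ℝ 1 W) (hWc : HasCompactSupport W) (hWs : tsupport W ⊆ Set.Ioo a b) :
    ∫ x, (∫ y, rlKernel (b - a) ν (x - y) * deriv V y) * W x =
      -∫ x, (∫ y, rlKernel (b - a) μ (x - y) * deriv V y) *
        ∫ z, rlKernel (b - a) μ (z - x) * deriv W z := by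
  have hV' := hV.continuous_deriv le_rfl
  have hW' := hW.continuous_deriv le_rfl
  have hV'i : Integrable (deriv V) := hV'.integrable_of_hasCompactSupport hVc.deriv
  obtain ⟨C, hC⟩ := hW'.bounded_above_of_compact_support hWc.deriv
  obtain ⟨C₀, hC₀⟩ := hW.continuous.bounded_above_of_compact_support hWc
  have hk := integrable_rlKernel (b - a) hμ
  have hkneg : Integrable fun s => rlKernel (b - a) μ (-s) := hk.comp_neg
  have hcont : Continuous fun x => ∫ z, rlKernel (b - a) μ (z - x) * deriv W z := by
    simpa using continuous_integral_kernel hkneg hW' hWc.deriv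
  have hbdd := norm_integral_kernel_le hkneg hC
  simp only [neg_sub] at hbdd
  have inner : ∀ y ∈ Set.Ioo a b, ∫ x, rlKernel (b - a) μ (x - y) *
      ∫ z, rlKernel (b - a) μ (z - x) * deriv W z = -∫ z, rlKernel (b - a) ν (z - y) * W z := by
    intro y hy
    rw [integral_mul_integral_kernel_comm hk (hk.comp_sub_right y) hW' hC,
      ← integral_rlKernel_mul_deriv hν hy.2 (by linarith [hy.1]) hW
        (hWs.trans Set.Ioo_subset_Iio_self)]
    congr 1 with z
    by_cases hz : z ∈ Set.Ioo a b
    · rw [integral_rlKernel_mul_rlKernel hμ hμ (by linarith [hz.2, hy.1]), hμν, mul_comm]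
    · rw [deriv_of_notMem_tsupport fun h => hz (hWs h), zero_mul, mul_zero]
  calc _ = ∫ z, W z * ∫ y, rlKernel (b - a) ν (z - y) * deriv V y := by
        simp_rw [mul_comm (W _)]
    _ = ∫ y, deriv V y * ∫ z, rlKernel (b - a) ν (z - y) * W z :=
        (integral_mul_integral_kernel_comm (integrable_rlKernel _ hν) hV'i hW.continuous hC₀).symm
    _ = -∫ y, deriv V y * ∫ x, rlKernel (b - a) μ (x - y) *
          ∫ z, rlKernel (b - a) μ (z - x) * deriv W z := by
        rw [← integral_neg]
        congr 1 with y
        by_cases hy : y ∈ Set.Ioo a b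
        · rw [inner y hy, mul_neg, neg_neg]
        · rw [deriv_of_notMem_tsupport fun h => hy (hVs h), zero_mul, zero_mul, neg_zero]
    _ = _ := by
        rw [integral_mul_integral_kernel_comm hk hV'i hcont hbdd]
        simp_rw [mul_comm (∫ z, rlKernel (b - a) μ (z - _) * deriv W z)]

section ChangeOfVariables

variable {ψ : ℝ → ℝ}

lemma setIntegral_Ioo_comp_mul_deriv (hψ : Differentiable ℝ ψ) (hmono : StrictMono ψ)
    (hsurj : Function.Surjective ψ) (hψ' : ∀ t, 0 < deriv ψ t) (G : ℝ → ℝ) (a b : ℝ) :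
    ∫ x in Set.Ioo (ψ a) (ψ b), G x = ∫ t in Set.Ioo a b, deriv ψ t * G (ψ t) := by
  have himg : ψ '' Set.Ioo a b = Set.Ioo (ψ a) (ψ b) :=
    (StrictMono.orderIsoOfSurjective ψ hmono hsurj).image_Ioo a b
  rw [← himg, integral_image_eq_integral_abs_deriv_smul measurableSet_Ioo
    (fun t _ => (hψ t).hasDerivAt.hasDerivWithinAt) hmono.injective.injOn]
  simp_rw [abs_of_pos (hψ' _), smul_eq_mul]

lemma exists_contDiff_comp_eq (hψ : ContDiff ℝ 1 ψ) (hmono : StrictMono ψ)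
    (hsurj : Function.Surjective ψ) (hψ' : ∀ t, 0 < deriv ψ t) {v : ℝ → ℝ} {a b : ℝ}
    (hv : ContDiff ℝ 1 v) (hvc : HasCompactSupport v) (hvs : tsupport v ⊆ Set.Ioo a b) :
    ∃ V : ℝ → ℝ, ContDiff ℝ 1 V ∧ HasCompactSupport V ∧ tsupport V ⊆ Set.Ioo (ψ a) (ψ b) ∧
      v = V ∘ ψ := by
  set e := StrictMono.orderIsoOfSurjective ψ hmono hsurj
  have hcont : Continuous e.symm := e.symm.continuous
  have hψe : ∀ y, ψ (e.symm y) = y := e.apply_symm_apply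
  have hderiv : ∀ x, HasDerivAt e.symm (deriv ψ (e.symm x))⁻¹ x := fun x =>
    (hψ.differentiable one_ne_zero _).hasDerivAt.of_local_left_inverse
      hcont.continuousAt (hψ' _).ne' (.of_forall hψe)
  have he : ContDiff ℝ 1 e.symm := by
    refine contDiff_one_iff_deriv.mpr ⟨fun x => (hderiv x).differentiableAt, ?_⟩
    rw [funext fun x => (hderiv x).deriv]
    exact ((hψ.continuous_deriv le_rfl).comp hcont).inv₀ fun x => (hψ' _).ne'
  refine ⟨v ∘ e.symm, hv.comp he, hvc.comp_homeomorph e.symm.toHomeomorph, fun x hx => ?_, ?_⟩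
  · have : e.symm x ∈ tsupport v := closure_minimal (t := e.symm ⁻¹' tsupport v)
      (fun y hy => subset_closure hy) ((isClosed_tsupport v).preimage hcont) hx
    have hx' := hvs this
    rw [← hψe x]
    exact ⟨hmono hx'.1, hmono hx'.2⟩
  · ext t
    exact congrArg v (e.symm_apply_apply t).symm

lemma leftPsiD_comp (hψ : Differentiable ℝ ψ) (hmono : StrictMono ψ)
    (hsurj : Function.Surjective ψ) (hψ' : ∀ t, 0 < deriv ψ t) {V : ℝ → ℝ} {a b δ : ℝ}
    (hδ : δ < 1) (hV : ContDiff ℝ 1 V) (hVc : HasCompactSupport V)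
    (hVs : tsupport V ⊆ Set.Ioo (ψ a) (ψ b)) {t : ℝ} (ht : t ∈ Set.Ioo a b) :
    leftPsiD ψ a δ (V ∘ ψ) t =
      ∫ y, rlKernel (ψ b - ψ a) (1 - δ) (ψ t - y) * deriv V y := by
  have hI : ∀ τ ∈ Set.Ioo a b, leftPsiI ψ a (1 - δ) (V ∘ ψ) τ =
      ∫ y, rlKernel (ψ b - ψ a) (1 - δ) (ψ τ - y) * V y := by
    intro τ hτ
    rw [integral_rlKernel_left (a := ψ a) (by linarith [hmono hτ.2])
      (fun z hz => image_eq_zero_of_notMem_tsupport fun h => (hVs h).1.not_ge hz),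
      setIntegral_Ioo_comp_mul_deriv hψ hmono hsurj hψ', leftPsiI,
      intervalIntegral.integral_of_le hτ.1.le, integral_Ioc_eq_integral_Ioo, ← integral_const_mul]
    congr 1 with z
    simp only [Function.comp_apply]
    ring
  have hd := (hasDerivAt_integral_kernel (integrable_rlKernel (ψ b - ψ a) (μ := 1 - δ)
    (by linarith)) hV hVc (ψ t)).comp t (hψ t).hasDerivAt
  rw [leftPsiD, (hd.congr_of_eventuallyEq
    (Filter.eventually_of_mem (Ioo_mem_nhds ht.1 ht.2) hI)).deriv]
  field_simp [(hψ' t).ne']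

lemma rightPsiD_comp (hψ : Differentiable ℝ ψ) (hmono : StrictMono ψ)
    (hsurj : Function.Surjective ψ) (hψ' : ∀ t, 0 < deriv ψ t) {W : ℝ → ℝ} {a b δ : ℝ}
    (hδ : δ < 1) (hW : ContDiff ℝ 1 W) (hWc : HasCompactSupport W)
    (hWs : tsupport W ⊆ Set.Ioo (ψ a) (ψ b)) {t : ℝ} (ht : t ∈ Set.Ioo a b) :
    rightPsiD ψ b δ (W ∘ ψ) t =
      -∫ z, rlKernel (ψ b - ψ a) (1 - δ) (z - ψ t) * deriv W z := by
  have hI : ∀ τ ∈ Set.Ioo a b, rightPsiI ψ b (1 - δ) (W ∘ ψ) τ =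
      ∫ z, rlKernel (ψ b - ψ a) (1 - δ) (z - ψ τ) * W z := by
    intro τ hτ
    rw [integral_rlKernel_right (b := ψ b) (by linarith [hmono hτ.1])
      (fun z hz => image_eq_zero_of_notMem_tsupport fun h => (hWs h).2.not_ge hz),
      setIntegral_Ioo_comp_mul_deriv hψ hmono hsurj hψ', rightPsiI,
      intervalIntegral.integral_of_le hτ.2.le, integral_Ioc_eq_integral_Ioo, ← integral_const_mul]
    congr 1 with z
    simp only [Function.comp_apply]
    ring
  have hd : HasDerivAt (fun τ => ∫ z, rlKernel (ψ b - ψ a) (1 - δ) (z - ψ τ) * W z)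
      ((∫ z, rlKernel (ψ b - ψ a) (1 - δ) (z - ψ t) * deriv W z) * deriv ψ t) t := by
    simpa [Function.comp_def] using (hasDerivAt_integral_kernel (integrable_rlKernel (ψ b - ψ a)
      (μ := 1 - δ) (by linarith)).comp_neg hW hWc (ψ t)).comp t (hψ t).hasDerivAt
  rw [rightPsiD, (hd.congr_of_eventuallyEq
    (Filter.eventually_of_mem (Ioo_mem_nhds ht.1 ht.2) hI)).deriv]
  field_simp [(hψ' t).ne']

end ChangeOfVariables

/-- Splitting of the ψ-fractional derivative of order δ into two derivatives of order δ/2: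
`(D^{δ,ψ}_t v, w)_{L²_ψ(Λ)} = (D^{δ/2,ψ}_t v, _tD^{δ/2,ψ} w)_{L²_ψ(Λ)}`. -/
theorem psi_fractional_derivative_splitting
    (δ : ℝ) (hδ0 : 0 < δ) (hδ1 : δ < 1)
    (ψ : ℝ → ℝ) (hψ : ContDiff ℝ 1 ψ) (hmono : StrictMono ψ)
    (hbij : Function.Bijective ψ) (hψ' : ∀ t, 0 < deriv ψ t)
    (a b : ℝ) (hab : a < b)
    (v : ℝ → ℝ) (hv : ContDiff ℝ (⊤ : ℕ∞) v) (hvsupp : HasCompactSupport v)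
    (hvsupp' : tsupport v ⊆ Set.Ioo a b)
    (w : ℝ → ℝ) (hw : ContDiff ℝ (⊤ : ℕ∞) w) (hwsupp : HasCompactSupport w)
    (hwsupp' : tsupport w ⊆ Set.Ioo a b) :
    ∫ t in a..b, leftPsiD ψ a δ v t * w t * deriv ψ t
      = ∫ t in a..b, leftPsiD ψ a (δ / 2) v t * rightPsiD ψ b (δ / 2) w t * deriv ψ t := by
  have hψd : Differentiable ℝ ψ := hψ.differentiable one_ne_zero
  have hsurj := hbij.surjective
  obtain ⟨V, hV, hVc, hVs, rfl⟩ := exists_contDiff_comp_eq hψ hmono hsurj hψ'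
    (hv.of_le (by exact_mod_cast le_top)) hvsupp hvsupp'
  obtain ⟨W, hW, hWc, hWs, rfl⟩ := exists_contDiff_comp_eq hψ hmono hsurj hψ'
    (hw.of_le (by exact_mod_cast le_top)) hwsupp hwsupp'
  have split := integral_rlKernel_splitting (μ := 1 - δ / 2) (ν := 1 - δ) (by linarith)
    (by linarith) (by ring) hV hVc hVs hW hWc hWs
  have hl : ∀ x ∉ Set.Ioo (ψ a) (ψ b),
      (∫ y, rlKernel (ψ b - ψ a) (1 - δ) (x - y) * deriv V y) * W x = 0 := by
    intro x hx
    rw [image_eq_zero_of_notMem_tsupport fun h => hx (hWs h), mul_zero]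
  have hr : ∀ x ∉ Set.Ioo (ψ a) (ψ b),
      -((∫ y, rlKernel (ψ b - ψ a) (1 - δ / 2) (x - y) * deriv V y) *
        ∫ z, rlKernel (ψ b - ψ a) (1 - δ / 2) (z - x) * deriv W z) = 0 := by
    intro x hx
    rcases le_or_gt x (ψ a) with h | h
    · rw [integral_rlKernel_left (a := ψ a) (by linarith [hmono hab])
        (fun z hz => deriv_of_notMem_tsupport fun h' => (hVs h').1.not_ge hz),
        Set.Ioo_eq_empty_of_le h]
      simp
    · have h' : ψ b ≤ x := not_lt.mp fun h' => hx ⟨h, h'⟩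
      rw [integral_rlKernel_right (b := ψ b) (by linarith [hmono hab])
        (fun z hz => deriv_of_notMem_tsupport fun h' => (hWs h').2.not_ge hz),
        Set.Ioo_eq_empty_of_le h']
      simp
  rw [← integral_neg,
    ← setIntegral_eq_integral_of_forall_compl_eq_zero (s := Set.Ioo (ψ a) (ψ b)) hl,
    ← setIntegral_eq_integral_of_forall_compl_eq_zero (s := Set.Ioo (ψ a) (ψ b)) hr,
    setIntegral_Ioo_comp_mul_deriv hψd hmono hsurj hψ',
    setIntegral_Ioo_comp_mul_deriv hψd hmono hsurj hψ'] at split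
  rw [intervalIntegral.integral_of_le hab.le, intervalIntegral.integral_of_le hab.le,
    integral_Ioc_eq_integral_Ioo, integral_Ioc_eq_integral_Ioo]
  refine (setIntegral_congr_fun measurableSet_Ioo fun t ht => ?_).trans
    (split.trans (setIntegral_congr_fun measurableSet_Ioo fun t ht => ?_))
  · rw [leftPsiD_comp hψd hmono hsurj hψ' hδ1 hV hVc hVs ht, Function.comp_apply]
    ring
  · rw [leftPsiD_comp hψd hmono hsurj hψ' (by linarith) hV hVc hVs ht,
      rightPsiD_comp hψd hmono hsurj hψ' (by linarith) hW hWc hWs ht]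
    ring
end

section
/- (Theorem 3.1: well-posedness and stability of the Galerkin spectral approximation.) Let λ > 0, N ≥ 1 an integer, and let V_N be the space of restrictions to Λ of real polynomials p of degree at most N with p(a_ψ) = 0. Define the bilinear form A(v,w) = (D^{δ,ψ}_t v, w)_{L²_ψ(Λ)} + λ (v,w)_{L²_ψ(Λ)} and, for f with ||f||_{L²_ψ(Λ)} < ∞ and ||I^{δ/2,ψ}_t f||_{L²_ψ(Λ)} < ∞, the linear functional F(w) = (f,w)_{L²_ψ(Λ)}. Then there exists a unique v_N ∈ V_N such that A(v_N, w) = F(w) for all w ∈ V_N; moreover there exists a constant C > 0 depending only on δ, λ, ψ and Λ (independent of N and f) such that ||v_N||_{L²_ψ(Λ)} ≤ C ||I^{δ/2,ψ}_t f||_{L²_ψ(Λ)}. -/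
open MeasureTheory Real

/-- Membership in `V_N`: (the restriction to `Λ` of) a real polynomial of degree at most `N`
vanishing at `a`. -/
def memVN (a : ℝ) (N : ℕ) (p : ℝ → ℝ) : Prop :=
  ∃ q : Polynomial ℝ, q.natDegree ≤ N ∧ q.eval a = 0 ∧ ∀ t, p t = q.eval t

section PosPow

/-- The truncated power `x₊ ^ γ`, with value `0` for `x ≤ 0`. -/
noncomputable def posPow (γ x : ℝ) : ℝ := if 0 < x then x ^ γ else 0

lemma posPow_of_pos {γ x : ℝ} (hx : 0 < x) : posPow γ x = x ^ γ := if_pos hx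

lemma posPow_of_nonpos {γ x : ℝ} (hx : x ≤ 0) : posPow γ x = 0 := if_neg hx.not_gt

lemma posPow_nonneg (γ x : ℝ) : 0 ≤ posPow γ x := by
  unfold posPow; split_ifs with h
  · positivity
  · exact le_rfl

lemma posPow_zero_nonneg_le_one (x : ℝ) : posPow 0 x ≤ 1 := by
  unfold posPow; split_ifs <;> simp

@[fun_prop]
lemma measurable_posPow (γ : ℝ) : Measurable (posPow γ) :=
  Measurable.ite measurableSet_Ioi (by fun_prop) measurable_const

lemma posPow_mul {γ d : ℝ} (hd : 0 < d) (x : ℝ) : posPow γ (d * x) = d ^ γ * posPow γ x := by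
  by_cases hx : 0 < x
  · rw [posPow_of_pos hx, posPow_of_pos (by positivity), Real.mul_rpow hd.le hx.le]
  · rw [posPow_of_nonpos (not_lt.1 hx), posPow_of_nonpos
      (mul_nonpos_of_nonneg_of_nonpos hd.le (not_lt.1 hx)), mul_zero]

lemma integrableOn_posPow_Iic {γ : ℝ} (hγ : -1 < γ) (T : ℝ) :
    IntegrableOn (posPow γ) (Set.Iic T) := by
  have h : IntegrableOn (posPow γ) (Set.Ioc 0 (max T 0)) := by
    have h1 := (intervalIntegral.intervalIntegrable_rpow' (a := 0) (b := max T 0) hγ).1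
    exact h1.congr_fun (fun x hx => (posPow_of_pos hx.1).symm) measurableSet_Ioc
  have h0 : IntegrableOn (posPow γ) (Set.Iic 0) :=
    integrableOn_zero.congr_fun (fun x hx => (posPow_of_nonpos hx).symm) measurableSet_Iic
  refine (h0.union h).mono_set fun x hx => ?_
  rcases le_or_gt x 0 with h' | h'
  · exact Or.inl h'
  · exact Or.inr ⟨h', le_max_of_le_left hx⟩

lemma setIntegral_posPow {γ : ℝ} (hγ : -1 < γ) {T : ℝ} :
    ∫ x in Set.Iic T, posPow γ x = posPow (γ + 1) T / (γ + 1) := by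
  have hz : ∀ T ≤ (0:ℝ), ∫ x in Set.Iic T, posPow γ x = 0 := fun T hT =>
    setIntegral_eq_zero_of_forall_eq_zero fun x hx => posPow_of_nonpos (le_trans hx hT)
  rcases le_or_gt T 0 with hT | hT
  · rw [posPow_of_nonpos hT, zero_div, hz T hT]
  · rw [posPow_of_pos hT]
    have h2 := intervalIntegral.integral_Iic_sub_Iic (μ := volume)
      (integrableOn_posPow_Iic hγ 0) (integrableOn_posPow_Iic hγ T)
    rw [hz 0 le_rfl, sub_zero] at h2
    rw [h2, intervalIntegral.integral_of_le hT.le,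
      setIntegral_congr_fun measurableSet_Ioc (fun x hx => posPow_of_pos hx.1),
      ← intervalIntegral.integral_of_le hT.le, integral_rpow (Or.inl hγ),
      Real.zero_rpow (by linarith), sub_zero]

end PosPow

section Increment

/-- The square of the unit increment of `x₊ ^ (-β)`, whose integral normalises the
moving-average representation of fractional Brownian motion. -/
noncomputable def incrSq (β x : ℝ) : ℝ := (posPow (-β) x - posPow (-β) (x + 1)) ^ 2

lemma integrable_incrSq {β : ℝ} (hβ : 0 < β) (hβ' : β < 1 / 2) : Integrable (incrSq β) := by
  have hmeas : Measurable (incrSq β) := by unfold incrSq; fun_prop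
  have hsq : ∀ x, posPow (-β) x ^ 2 = posPow (-(2 * β)) x := by
    intro x
    rcases le_or_gt x 0 with h | h
    · simp [posPow_of_nonpos h]
    · rw [posPow_of_pos h, posPow_of_pos h, ← Real.rpow_natCast, ← Real.rpow_mul h.le]
      congr 1; push_cast; ring
  have h1 : IntegrableOn (incrSq β) (Set.Iic 1) := by
    have a1 := integrableOn_posPow_Iic (γ := -(2 * β)) (by linarith) 1
    have a2 : IntegrableOn (fun x => posPow (-(2 * β)) (x + 1)) (Set.Iic 1) := by
      have := integrableOn_posPow_Iic (γ := -(2 * β)) (by linarith) 2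
      have := ((integrable_indicator_iff measurableSet_Iic).2 this).comp_add_right 1
      refine (this.integrableOn (s := Set.Iic 1)).congr_fun (fun x hx => ?_) measurableSet_Iic
      have hx' : x + 1 ∈ Set.Iic (2:ℝ) := by
        have := Set.mem_Iic.1 hx
        simp only [Set.mem_Iic]; linarith
      simp only [Set.indicator_of_mem hx']
    refine (a1.add a2).mono' hmeas.aestronglyMeasurable (Filter.Eventually.of_forall fun x => ?_)
    simp only [Pi.add_apply]
    rw [← hsq, ← hsq, incrSq, Real.norm_of_nonneg (sq_nonneg _)]
    nlinarith [mul_nonneg (posPow_nonneg (-β) x) (posPow_nonneg (-β) (x + 1))]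
  have h2 : IntegrableOn (incrSq β) (Set.Ioi 1) := by
    refine (integrableOn_Ioi_rpow_of_lt (a := -2) (by norm_num) one_pos).mono'
      hmeas.aestronglyMeasurable ((ae_restrict_iff' measurableSet_Ioi).2
        (Filter.Eventually.of_forall fun x hx => ?_))
    have hx1 : 1 < x := hx
    have hx0 : 0 < x := by linarith
    rw [incrSq, Real.norm_of_nonneg (sq_nonneg _), posPow_of_pos hx0, posPow_of_pos (by linarith)]
    have e2 : x ^ (-2 : ℝ) = (x⁻¹) ^ 2 := by
      rw [Real.rpow_neg hx0.le, inv_pow]; norm_num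
    rw [e2]
    have q1 : (x + 1) ^ (-β) ≤ x ^ (-β) :=
      Real.rpow_le_rpow_of_nonpos hx0 (by linarith) (by linarith)
    have q2 : x ^ (-β) ≤ 1 := Real.rpow_le_one_of_one_le_of_nonpos hx1.le (by linarith)
    have q3 : x ^ (-β) * (x / (x + 1)) ≤ (x + 1) ^ (-β) := by
      have : (x / (x + 1)) ≤ (x / (x + 1)) ^ β := by
        have := Real.rpow_le_rpow_of_exponent_ge (x := x / (x + 1)) (y := 1) (z := β)
          (by positivity) (by rw [div_le_one (by linarith)]; linarith) (by linarith)
        rwa [Real.rpow_one] at this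
      calc x ^ (-β) * (x / (x + 1)) ≤ x ^ (-β) * (x / (x + 1)) ^ β := by gcongr
        _ = (x + 1) ^ (-β) := by
          rw [Real.div_rpow hx0.le (by linarith), Real.rpow_neg hx0.le,
            Real.rpow_neg (by linarith : (0:ℝ) ≤ x + 1)]
          have : x ^ β ≠ 0 := (Real.rpow_pos_of_pos hx0 _).ne'
          field_simp
    refine pow_le_pow_left₀ (by linarith) ?_ 2
    have e3 : x / (x + 1) = 1 - (x + 1)⁻¹ := by field_simp; ring
    have q4 : (x + 1)⁻¹ ≤ x⁻¹ := inv_anti₀ hx0 (by linarith)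
    have q5 : 0 < (x + 1)⁻¹ := by positivity
    rw [e3] at q3
    nlinarith
  have := h1.union h2
  rwa [Set.Iic_union_Ioi, integrableOn_univ] at this

lemma integral_incrSq_pos {β : ℝ} (hβ : 0 < β) (hβ' : β < 1 / 2) : 0 < ∫ x, incrSq β x := by
  rw [integral_pos_iff_support_of_nonneg (f := incrSq β) (fun x => sq_nonneg _)
    (integrable_incrSq hβ hβ')]
  refine lt_of_lt_of_le ?_ (measure_mono (s := Set.Ioo (-1 : ℝ) 0) fun x hx => ?_)
  · simp
  · have h : 0 < x + 1 := by linarith [hx.1]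
    have := Real.rpow_pos_of_pos h (-β)
    simp only [Function.mem_support, incrSq, posPow_of_nonpos hx.2.le, posPow_of_pos h]
    exact pow_ne_zero 2 (by rw [zero_sub]; exact neg_ne_zero.2 this.ne')

/-- Scaling and translation of the squared increments of `x₊ ^ (-β)`. -/
lemma integral_posPow_sub_sq {β : ℝ} (hβ : 0 < β) (hβ' : β < 1 / 2) (r r' : ℝ) :
    Integrable (fun s => (posPow (-β) (r - s) - posPow (-β) (r' - s)) ^ 2) ∧
    ∫ s, (posPow (-β) (r - s) - posPow (-β) (r' - s)) ^ 2 =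
      |r - r'| ^ (1 - 2 * β) * ∫ x, incrSq β x := by
  wlog h : r ≤ r' generalizing r r'
  · have := this r' r (by linarith)
    rw [abs_sub_comm]
    simpa only [sub_sq_comm] using this
  rcases h.eq_or_lt with rfl | h
  · simp [Real.zero_rpow (by linarith : 1 - 2 * β ≠ 0)]
  set d := r' - r with hd
  have hd0 : 0 < d := sub_pos.2 h
  have key : (fun s => (posPow (-β) (r - s) - posPow (-β) (r' - s)) ^ 2) =
      fun s => (fun y => d ^ (-(2 * β)) * incrSq β (d⁻¹ * y)) (r - s) := by
    ext s
    have e1 : r - s = d * (d⁻¹ * (r - s)) := by field_simp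
    have e2 : r' - s = d * (d⁻¹ * (r - s) + 1) := by field_simp; simp [hd]
    rw [e1, e2, posPow_mul hd0, posPow_mul hd0, ← e1, ← mul_sub, mul_pow]
    simp only [incrSq]
    congr 1
    rw [← Real.rpow_natCast, ← Real.rpow_mul hd0.le]
    congr 1; push_cast; ring
  rw [key]
  constructor
  · exact (((integrable_incrSq hβ hβ').comp_mul_left' (inv_ne_zero hd0.ne')).const_mul
      _).comp_sub_left r
  · rw [integral_sub_left_eq_self (fun y => d ^ (-(2 * β)) * incrSq β (d⁻¹ * y)),
      integral_const_mul,
      Measure.integral_comp_mul_left, inv_inv, abs_of_pos hd0, abs_sub_comm, ← hd,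
      abs_of_pos hd0, smul_eq_mul, ← mul_assoc]
    congr 1
    rw [sub_eq_neg_add, Real.rpow_add hd0, Real.rpow_one]

end Increment

section Beta

lemma integrable_posPow_mul_posPow_one_sub {β : ℝ} (hβ : 0 < β) (hβ' : β < 1) :
    Integrable fun x => posPow (β - 1) x * posPow (-β) (1 - x) := by
  have h := (Complex.betaIntegral_convergent (u := β) (v := ((1 - β : ℝ) : ℂ))
    (by simpa) (by simpa)).norm
  rw [intervalIntegrable_iff_integrableOn_Ioo_of_le zero_le_one] at h
  have h' : IntegrableOn (fun x => posPow (β - 1) x * posPow (-β) (1 - x)) (Set.Ioo 0 1) := by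
    refine h.congr_fun (fun x hx => ?_) measurableSet_Ioo
    have hx1 : 0 < 1 - x := by linarith [hx.2]
    have e : (1 - x : ℂ) = ((1 - x : ℝ) : ℂ) := by push_cast; rfl
    simp only [norm_mul]
    rw [e, Complex.norm_cpow_eq_rpow_re_of_pos hx.1, Complex.norm_cpow_eq_rpow_re_of_pos hx1,
      posPow_of_pos hx.1, posPow_of_pos hx1]
    simp
  refine (integrableOn_iff_integrable_of_support_subset fun x hx => ?_).1 h'
  rw [Function.mem_support] at hx
  by_contra hc
  apply hx
  rcases le_or_gt x 0 with h0 | h0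
  · rw [posPow_of_nonpos h0, zero_mul]
  · rw [posPow_of_nonpos (x := 1 - x) (by by_contra h1; exact hc ⟨h0, by linarith⟩), mul_zero]

/-- The Beta integral `B(β, 1 - β)`. -/
noncomputable def betaConst (β : ℝ) : ℝ := ∫ x, posPow (β - 1) x * posPow (-β) (1 - x)

lemma betaConst_pos {β : ℝ} (hβ : 0 < β) (hβ' : β < 1) : 0 < betaConst β := by
  rw [betaConst, integral_pos_iff_support_of_nonneg
    (fun x => mul_nonneg (posPow_nonneg _ _) (posPow_nonneg _ _))
    (integrable_posPow_mul_posPow_one_sub hβ hβ')]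
  refine lt_of_lt_of_le ?_ (measure_mono (s := Set.Ioo (0 : ℝ) 1) fun x hx => ?_)
  · simp
  · have h : 0 < 1 - x := by linarith [hx.2]
    have h1 := Real.rpow_pos_of_pos h (-β)
    have h2 := Real.rpow_pos_of_pos hx.1 (β - 1)
    simp only [Function.mem_support, posPow_of_pos hx.1, posPow_of_pos h]
    positivity

lemma integral_posPow_mul_posPow {β : ℝ} (hβ : 0 < β) (hβ' : β < 1) (z r : ℝ) :
    Integrable (fun s => posPow (β - 1) (s - z) * posPow (-β) (r - s)) ∧
    ∫ s, posPow (β - 1) (s - z) * posPow (-β) (r - s) = betaConst β * posPow 0 (r - z) := by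
  rcases le_or_gt r z with h | h
  · have : (fun s => posPow (β - 1) (s - z) * posPow (-β) (r - s)) = 0 := by
      ext s
      rcases le_or_gt s z with h1 | h1
      · simp [posPow_of_nonpos (sub_nonpos.2 h1)]
      · simp [posPow_of_nonpos (x := r - s) (by linarith)]
    rw [this, posPow_of_nonpos (sub_nonpos.2 h)]
    exact ⟨integrable_zero _ _ _, by simp⟩
  · set d := r - z with hd
    have hd0 : 0 < d := sub_pos.2 h
    have key : (fun s => posPow (β - 1) (s - z) * posPow (-β) (r - s)) = fun s =>
        (fun y => d⁻¹ * (fun x => posPow (β - 1) x * posPow (-β) (1 - x)) (d⁻¹ * y)) (s - z) := by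
      ext s
      have e1 : s - z = d * (d⁻¹ * (s - z)) := by field_simp
      have e2 : r - s = d * (1 - d⁻¹ * (s - z)) := by field_simp; rw [hd]; ring
      rw [e1, e2, posPow_mul hd0, posPow_mul hd0, ← e1]
      have e3 : d⁻¹ = d ^ (β - 1) * d ^ (-β) := by
        rw [← Real.rpow_add hd0, ← Real.rpow_neg_one]; congr 1; ring
      simp only []
      nth_rewrite 3 [e3]
      ring
    rw [key]
    constructor
    · exact (((integrable_posPow_mul_posPow_one_sub hβ hβ').comp_mul_left'
        (inv_ne_zero hd0.ne')).const_mul _).comp_sub_right z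
    · rw [integral_sub_right_eq_self (fun y => d⁻¹ *
        (fun x => posPow (β - 1) x * posPow (-β) (1 - x)) (d⁻¹ * y)), integral_const_mul,
        Measure.integral_comp_mul_left (fun x => posPow (β - 1) x * posPow (-β) (1 - x)),
        inv_inv, abs_of_pos hd0, posPow_of_pos hd0,
        Real.rpow_zero, mul_one, smul_eq_mul, ← mul_assoc, inv_mul_cancel₀ hd0.ne', one_mul]
      rfl

end Beta

section Kernel

variable {X Y : Type*} [MeasurableSpace X] [MeasurableSpace Y]

lemma integrable_weighted_kernel {ν : Measure X} [SFinite ν] {μ : Measure Y} [SFinite μ]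
    {w : X → ℝ} (hw : Integrable w ν) {k : X → Y → ℝ} (hk : Measurable (Function.uncurry k))
    {C : ℝ} (hC : ∀ᵐ x ∂ν, Integrable (k x) μ ∧ ∫ s, |k x s| ∂μ ≤ C) :
    Integrable (fun z : X × Y => w z.1 * k z.1 z.2) (ν.prod μ) := by
  have hm : AEStronglyMeasurable (fun z : X × Y => w z.1 * k z.1 z.2) (ν.prod μ) :=
    hw.aestronglyMeasurable.comp_fst.mul hk.aestronglyMeasurable
  rw [integrable_prod_iff hm]
  refine ⟨hC.mono fun x hx => hx.1.const_mul (w x), ?_⟩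
  refine (hw.norm.mul_const C).mono' hm.norm.integral_prod_right' (hC.mono fun x hx => ?_)
  simp only [norm_mul, integral_const_mul]
  rw [norm_norm, Real.norm_of_nonneg (integral_nonneg fun _ => norm_nonneg _)]
  exact mul_le_mul_of_nonneg_left hx.2 (norm_nonneg _)

lemma integral_weighted_kernel {ν : Measure X} [SFinite ν] {μ : Measure Y} [SFinite μ]
    {w : X → ℝ} (hw : Integrable w ν) {k : X → Y → ℝ} (hk : Measurable (Function.uncurry k))
    {C : ℝ} (hC : ∀ᵐ x ∂ν, Integrable (k x) μ ∧ ∫ s, |k x s| ∂μ ≤ C) :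
    Integrable (fun s => ∫ x, w x * k x s ∂ν) μ ∧
    Integrable (fun x => w x * ∫ s, k x s ∂μ) ν ∧
    ∫ s, ∫ x, w x * k x s ∂ν ∂μ = ∫ x, w x * ∫ s, k x s ∂μ ∂ν := by
  have h := integrable_weighted_kernel hw hk hC
  refine ⟨h.integral_prod_right, ?_, ?_⟩
  · simpa only [integral_const_mul] using h.integral_prod_left
  · rw [← integral_integral_swap h]
    simp only [integral_const_mul]

end Kernel

lemma ae_mem_Ioc_prod (A B : ℝ) :
    ∀ᵐ x ∂((volume.restrict (Set.Ioc A B)).prod (volume.restrict (Set.Ioc A B))),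
      x.1 ∈ Set.Ioc A B ∧ x.2 ∈ Set.Ioc A B := by
  rw [Measure.prod_restrict]
  exact ae_restrict_mem (measurableSet_Ioc.prod measurableSet_Ioc)

lemma posPow_eq_abs {α x : ℝ} (hα : α ≠ 0) (hx : 0 ≤ x) : posPow α x = |x| ^ α := by
  rcases hx.eq_or_lt with rfl | h
  · simp [posPow_of_nonpos le_rfl, Real.zero_rpow hα]
  · rw [posPow_of_pos h, abs_of_pos h]

lemma posPow_add_posPow_neg {α : ℝ} (hα : α ≠ 0) (x : ℝ) :
    posPow α x + posPow α (-x) = |x| ^ α := by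
  rcases le_total 0 x with h | h
  · rw [posPow_of_nonpos (x := -x) (by linarith), add_zero, posPow_eq_abs hα h]
  · rw [posPow_of_nonpos h, zero_add, posPow_eq_abs hα (by linarith), abs_neg]

lemma posPow_mono {α : ℝ} (hα : 0 ≤ α) : Monotone (posPow α) := by
  intro x y h
  rcases le_or_gt x 0 with hx | hx
  · rw [posPow_of_nonpos hx]; exact posPow_nonneg _ _
  · rw [posPow_of_pos hx, posPow_of_pos (hx.trans_le h)]
    exact Real.rpow_le_rpow hx.le h hα

lemma integrableOn_posPow_sub {γ : ℝ} (hγ : -1 < γ) (r T : ℝ) :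
    IntegrableOn (fun s => posPow γ (s - r)) (Set.Iic T) := by
  have h := ((integrable_indicator_iff measurableSet_Iic).2
    (integrableOn_posPow_Iic hγ (T - r))).comp_sub_right r
  refine (h.integrableOn (s := Set.Iic T)).congr_fun (fun x hx => ?_) measurableSet_Iic
  have hx' : x - r ∈ Set.Iic (T - r) := sub_le_sub_right (Set.mem_Iic.1 hx) r
  simp only [Set.indicator_of_mem hx']

lemma setIntegral_posPow_sub {γ : ℝ} (hγ : -1 < γ) (r T : ℝ) :
    ∫ s in Set.Iic T, posPow γ (s - r) = posPow (γ + 1) (T - r) / (γ + 1) := by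
  rw [← setIntegral_posPow hγ, ← integral_indicator measurableSet_Iic,
    ← integral_indicator measurableSet_Iic,
    ← integral_sub_right_eq_self ((Set.Iic (T - r)).indicator (posPow γ)) r]
  congr 1; ext s
  simp only [Set.indicator, Set.mem_Iic, sub_le_sub_iff_right]

lemma setIntegral_posPow_mul_posPow_zero {γ : ℝ} (hγ : -1 < γ) {A B r r' : ℝ}
    (hA : A ≤ r') (hB : r' ≤ B) :
    IntegrableOn (fun s => posPow γ (s - r) * posPow 0 (s - r')) (Set.Ioc A B) ∧
    ∫ s in Set.Ioc A B, posPow γ (s - r) * posPow 0 (s - r') =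
      (posPow (γ + 1) (B - r) - posPow (γ + 1) (r' - r)) / (γ + 1) := by
  have e : (fun s => posPow γ (s - r) * posPow 0 (s - r')) =
      (Set.Ioi r').indicator fun s => posPow γ (s - r) := by
    ext s
    by_cases h : r' < s
    · rw [Set.indicator_of_mem (Set.mem_Ioi.2 h), posPow_of_pos (γ := 0) (sub_pos.2 h),
        Real.rpow_zero, mul_one]
    · rw [Set.indicator_of_notMem (mt Set.mem_Ioi.1 h),
        posPow_of_nonpos (γ := 0) (by linarith), mul_zero]
  have hset : Set.Ioc A B ∩ Set.Ioi r' = Set.Ioc r' B := by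
    ext x; simp only [Set.mem_inter_iff, Set.mem_Ioc, Set.mem_Ioi]
    exact ⟨fun h => ⟨h.2, h.1.2⟩, fun h => ⟨⟨hA.trans_lt h.1, h.2⟩, h.1⟩⟩
  rw [e]
  constructor
  · exact ((integrableOn_posPow_sub hγ r B).mono_set Set.Ioc_subset_Iic_self).indicator
      measurableSet_Ioi
  · rw [setIntegral_indicator measurableSet_Ioi, hset, ← intervalIntegral.integral_of_le hB,
      ← intervalIntegral.integral_Iic_sub_Iic (integrableOn_posPow_sub hγ r r')
        (integrableOn_posPow_sub hγ r B), setIntegral_posPow_sub hγ, setIntegral_posPow_sub hγ,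
      sub_div]

section Energy

/-- Up to a constant factor, the right fractional derivative of order `β` on `(-∞, B)` of the
function with derivative `φ` on `(A, B)`, vanishing at `A` and extended by zero. -/
noncomputable def rightFrac (β A B : ℝ) (φ : ℝ → ℝ) (s : ℝ) : ℝ :=
  ∫ r in Set.Ioc A B, φ r * (posPow (-β) (r - s) - posPow (-β) (B - s))

/-- The unnormalised left fractional integral of order `γ + 1` of `φ` on `(A, B)`. -/
noncomputable def leftFrac (γ A B : ℝ) (φ : ℝ → ℝ) (s : ℝ) : ℝ :=
  ∫ r in Set.Ioc A B, φ r * posPow γ (s - r)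

lemma integral_mul_increments {β : ℝ} (hβ : 0 < β) (hβ' : β < 1 / 2) (B r r' : ℝ) :
    Integrable (fun s => (posPow (-β) (r - s) - posPow (-β) (B - s)) *
      (posPow (-β) (r' - s) - posPow (-β) (B - s))) ∧
    ∫ s, (posPow (-β) (r - s) - posPow (-β) (B - s)) *
      (posPow (-β) (r' - s) - posPow (-β) (B - s)) =
      (∫ x, incrSq β x) / 2 * (|r - B| ^ (1 - 2 * β) + |r' - B| ^ (1 - 2 * β)
        - |r - r'| ^ (1 - 2 * β)) := by
  obtain ⟨i1, e1⟩ := integral_posPow_sub_sq hβ hβ' r B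
  obtain ⟨i2, e2⟩ := integral_posPow_sub_sq hβ hβ' r' B
  obtain ⟨i3, e3⟩ := integral_posPow_sub_sq hβ hβ' r r'
  have key : (fun s => (posPow (-β) (r - s) - posPow (-β) (B - s)) *
      (posPow (-β) (r' - s) - posPow (-β) (B - s))) = fun s =>
      1 / 2 * ((posPow (-β) (r - s) - posPow (-β) (B - s)) ^ 2 +
        (posPow (-β) (r' - s) - posPow (-β) (B - s)) ^ 2 -
        (posPow (-β) (r - s) - posPow (-β) (r' - s)) ^ 2) := by
    ext s; ring
  rw [key]
  refine ⟨((i1.add i2).sub i3).const_mul _, ?_⟩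
  have i12 := i1.add i2
  simp only [Pi.add_def] at i12
  rw [integral_const_mul, integral_sub i12 i3, integral_add i1 i2, e1, e2, e3]
  ring

lemma integral_abs_mul_increments_le {β : ℝ} (hβ : 0 < β) (hβ' : β < 1 / 2) {A B r r' : ℝ}
    (hr : r ∈ Set.Ioc A B) (hr' : r' ∈ Set.Ioc A B) :
    ∫ s, |(posPow (-β) (r - s) - posPow (-β) (B - s)) *
      (posPow (-β) (r' - s) - posPow (-β) (B - s))| ≤
      (B - A) ^ (1 - 2 * β) * ∫ x, incrSq β x := by
  obtain ⟨i1, e1⟩ := integral_posPow_sub_sq hβ hβ' r B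
  obtain ⟨i2, e2⟩ := integral_posPow_sub_sq hβ hβ' r' B
  have hc := (integral_incrSq_pos hβ hβ').le
  have hb : ∀ x ∈ Set.Ioc A B, |x - B| ^ (1 - 2 * β) ≤ (B - A) ^ (1 - 2 * β) := fun x hx => by
    refine Real.rpow_le_rpow (abs_nonneg _) ?_ (by linarith)
    rw [abs_sub_comm, abs_of_nonneg (by linarith [hx.2])]
    linarith [hx.1]
  calc _ ≤ ∫ s, (1 / 2 * (posPow (-β) (r - s) - posPow (-β) (B - s)) ^ 2 +
        1 / 2 * (posPow (-β) (r' - s) - posPow (-β) (B - s)) ^ 2) := by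
        refine integral_mono (integral_mul_increments hβ hβ' B r r').1.abs
          ((i1.const_mul _).add (i2.const_mul _)) fun s => ?_
        simp only [abs_mul]
        nlinarith [sq_nonneg (|posPow (-β) (r - s) - posPow (-β) (B - s)| -
          |posPow (-β) (r' - s) - posPow (-β) (B - s)|),
          sq_abs (posPow (-β) (r - s) - posPow (-β) (B - s)),
          sq_abs (posPow (-β) (r' - s) - posPow (-β) (B - s))]
    _ = (1 / 2 * |r - B| ^ (1 - 2 * β) + 1 / 2 * |r' - B| ^ (1 - 2 * β)) *
        ∫ x, incrSq β x := by
        rw [integral_add (i1.const_mul _) (i2.const_mul _), integral_const_mul,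
          integral_const_mul, e1, e2]
        ring
    _ ≤ _ := by
        gcongr
        linarith [hb r hr, hb r' hr']

/-- The energy identity: the form `(D^{2β} u, u)` is a multiple of the squared `L²` norm of the
right fractional derivative of order `β` on the half-line. -/
lemma integral_rightFrac_sq {β : ℝ} (hβ : 0 < β) (hβ' : β < 1 / 2) {A B : ℝ}
    {φ : ℝ → ℝ} (hφ : IntegrableOn φ (Set.Ioc A B)) :
    Integrable (fun s => rightFrac β A B φ s ^ 2) ∧
    ∫ s, rightFrac β A B φ s ^ 2 = (∫ x, incrSq β x) * (1 - 2 * β) *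
      ∫ s in Set.Ioc A B, leftFrac (-(2 * β)) A B φ s * leftFrac 0 A B φ s := by
  set m := volume.restrict (Set.Ioc A B) with hm
  set α := 1 - 2 * β with hα
  have hα0 : 0 < α := by rw [hα]; linarith
  set c := ∫ x, incrSq β x with hc
  have hw : Integrable (fun x : ℝ × ℝ => φ x.1 * φ x.2) (m.prod m) := hφ.mul_prod hφ
  have hmem := ae_mem_Ioc_prod A B
  set k : ℝ × ℝ → ℝ → ℝ := fun x s => (posPow (-β) (x.1 - s) - posPow (-β) (B - s)) *
      (posPow (-β) (x.2 - s) - posPow (-β) (B - s)) with hk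
  set l : ℝ × ℝ → ℝ → ℝ := fun x s => posPow (-(2 * β)) (s - x.1) * posPow 0 (s - x.2) with hl
  obtain ⟨k1, -, k3⟩ := integral_weighted_kernel (μ := volume) hw (k := k)
    (by simp only [hk, Function.uncurry_def]; fun_prop)
    (C := (B - A) ^ α * c) (hmem.mono fun x hx =>
      ⟨(integral_mul_increments hβ hβ' B x.1 x.2).1,
        integral_abs_mul_increments_le hβ hβ' hx.1 hx.2⟩)
  have hlint : ∀ x : ℝ × ℝ, x.1 ∈ Set.Ioc A B ∧ x.2 ∈ Set.Ioc A B →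
      Integrable (l x) m ∧ ∫ s, l x s ∂m =
        (posPow α (B - x.1) - posPow α (x.2 - x.1)) / α := fun x hx => by
    have := setIntegral_posPow_mul_posPow_zero (γ := -(2 * β)) (by linarith) (r := x.1)
      hx.2.1.le hx.2.2
    rwa [show -(2 * β) + 1 = α by rw [hα]; ring] at this
  obtain ⟨-, l2, l3⟩ := integral_weighted_kernel (μ := m) hw (k := l)
    (by simp only [hl, Function.uncurry_def]; fun_prop)
    (C := posPow α (B - A) / α) (hmem.mono fun x hx => by
      refine ⟨(hlint x hx).1, ?_⟩
      have : ∀ s, |l x s| = l x s := fun s =>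
        abs_of_nonneg (mul_nonneg (posPow_nonneg _ _) (posPow_nonneg _ _))
      simp only [this]
      rw [(hlint x hx).2]
      gcongr
      have h1 := posPow_nonneg α (x.2 - x.1)
      have h2 := posPow_mono hα0.le (show B - x.1 ≤ B - A by linarith [hx.1.1])
      linarith)
  have ek : ∀ s, ∫ x, φ x.1 * φ x.2 * k x s ∂(m.prod m) = rightFrac β A B φ s ^ 2 := fun s => by
    rw [sq, rightFrac, ← integral_prod_mul]
    congr 1; ext x; simp only [hk]; ring
  have el : ∀ s, ∫ x, φ x.1 * φ x.2 * l x s ∂(m.prod m) =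
      leftFrac (-(2 * β)) A B φ s * leftFrac 0 A B φ s := fun s => by
    rw [leftFrac, leftFrac, ← integral_prod_mul]
    congr 1; ext x; simp only [hl]; ring
  simp only [ek] at k1 k3
  simp only [el] at l3
  refine ⟨k1, ?_⟩
  rw [k3, l3]
  have hs := integral_prod_swap (μ := m) (ν := m)
    (fun x : ℝ × ℝ => φ x.1 * φ x.2 * ∫ s, l x s ∂m)
  have hs2 : Integrable (fun x : ℝ × ℝ => φ x.swap.1 * φ x.swap.2 * ∫ s, l x.swap s ∂m)
    (m.prod m) := l2.swap
  have : ∫ x, φ x.1 * φ x.2 * (∫ s, k x s) ∂(m.prod m) =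
      ∫ x, (c * α / 2 * (φ x.1 * φ x.2 * ∫ s, l x s ∂m) +
        c * α / 2 * (φ x.swap.1 * φ x.swap.2 * ∫ s, l x.swap s ∂m)) ∂(m.prod m) := by
    refine integral_congr_ae (hmem.mono fun x hx => ?_)
    simp only []
    rw [(integral_mul_increments hβ hβ' B x.1 x.2).2, (hlint x hx).2, (hlint x.swap hx.symm).2,
      ← posPow_add_posPow_neg hα0.ne' (x.1 - x.2), neg_sub, abs_sub_comm, abs_sub_comm x.2,
      ← posPow_eq_abs hα0.ne' (sub_nonneg.2 hx.1.2), ← posPow_eq_abs hα0.ne' (sub_nonneg.2 hx.2.2)]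
    simp only [Prod.fst_swap, Prod.snd_swap]
    field_simp
    ring
  rw [this, integral_add (l2.const_mul _) (hs2.const_mul _), integral_const_mul,
    integral_const_mul, hs]
  ring

/-- Duality between the left fractional integral of order `β` and the right fractional
derivative of order `β`. -/
lemma integral_leftFrac_mul_rightFrac {β : ℝ} (hβ : 0 < β) (hβ' : β < 1 / 2) {A B : ℝ}
    {f φ : ℝ → ℝ} (hf : IntegrableOn f (Set.Ioc A B)) (hφ : IntegrableOn φ (Set.Ioc A B)) :
    Integrable (fun s => leftFrac (β - 1) A B f s * rightFrac β A B φ s) ∧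
    ∫ s in Set.Ioc A B, leftFrac (β - 1) A B f s * rightFrac β A B φ s = - betaConst β *
      ∫ z in Set.Ioc A B, f z * leftFrac 0 A B φ z := by
  set m := volume.restrict (Set.Ioc A B) with hm
  have hw : Integrable (fun x : ℝ × ℝ => f x.1 * φ x.2) (m.prod m) := hf.mul_prod hφ
  have hmem := ae_mem_Ioc_prod A B
  have hβ1 : β < 1 := by linarith
  set k : ℝ × ℝ → ℝ → ℝ := fun x s => posPow (β - 1) (s - x.1) *
      (posPow (-β) (x.2 - s) - posPow (-β) (B - s)) with hk
  have hkint : ∀ x, Integrable (k x) ∧ ∫ s, k x s =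
      betaConst β * posPow 0 (x.2 - x.1) - betaConst β * posPow 0 (B - x.1) := fun x => by
    obtain ⟨i1, e1⟩ := integral_posPow_mul_posPow hβ hβ1 x.1 x.2
    obtain ⟨i2, e2⟩ := integral_posPow_mul_posPow hβ hβ1 x.1 B
    rw [← e1, ← e2, ← integral_sub i1 i2]
    simp only [hk, mul_sub]
    exact ⟨i1.sub i2, trivial⟩
  obtain ⟨k1, k2, k3⟩ := integral_weighted_kernel (μ := volume) hw (k := k)
    (by simp only [hk, Function.uncurry_def]; fun_prop)
    (C := 2 * betaConst β) (Filter.Eventually.of_forall fun x => by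
      refine ⟨(hkint x).1, ?_⟩
      obtain ⟨i1, e1⟩ := integral_posPow_mul_posPow hβ hβ1 x.1 x.2
      obtain ⟨i2, e2⟩ := integral_posPow_mul_posPow hβ hβ1 x.1 B
      have hb := betaConst_pos hβ hβ1
      calc _ ≤ ∫ s, (posPow (β - 1) (s - x.1) * posPow (-β) (x.2 - s) +
          posPow (β - 1) (s - x.1) * posPow (-β) (B - s)) := by
            refine integral_mono (hkint x).1.abs (i1.add i2) fun s => ?_
            simp only [hk]
            rw [abs_mul, abs_of_nonneg (posPow_nonneg _ _), ← mul_add]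
            refine mul_le_mul_of_nonneg_left ?_ (posPow_nonneg _ _)
            have h1 := posPow_nonneg (-β) (x.2 - s)
            have h2 := posPow_nonneg (-β) (B - s)
            exact abs_le.2 ⟨by linarith, by linarith⟩
        _ ≤ _ := by
            rw [integral_add i1 i2, e1, e2]
            nlinarith [posPow_zero_nonneg_le_one (x.2 - x.1), posPow_zero_nonneg_le_one (B - x.1)])
  have ek : ∀ s, ∫ x, f x.1 * φ x.2 * k x s ∂(m.prod m) =
      leftFrac (β - 1) A B f s * rightFrac β A B φ s := fun s => by
    rw [leftFrac, rightFrac, ← integral_prod_mul]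
    congr 1; ext x; simp only [hk]; ring
  simp only [ek] at k1 k3
  refine ⟨k1, ?_⟩
  rw [setIntegral_eq_integral_of_forall_compl_eq_zero, k3]
  · rw [integral_prod _ k2, ← integral_const_mul]
    have hB : ∀ᵐ x ∂m, x ∈ Set.Ioo A B := by
      rw [hm, ← restrict_Ioo_eq_restrict_Ioc]
      exact ae_restrict_mem measurableSet_Ioo
    refine integral_congr_ae (hB.mono fun z hz => ?_)
    simp only []
    rw [leftFrac, ← mul_assoc, ← integral_const_mul]
    have hne : ∀ᵐ r ∂m, r ≠ z := ae_restrict_of_ae (Measure.ae_ne volume z)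
    refine integral_congr_ae (hne.mono fun r hr => ?_)
    simp only []
    rw [(hkint (z, r)).2, posPow_of_pos (x := B - z) (sub_pos.2 hz.2), Real.rpow_zero]
    rcases hr.lt_or_gt with h | h
    · rw [posPow_of_nonpos (by simp only []; linarith), posPow_of_pos (by linarith), Real.rpow_zero]
      ring
    · rw [posPow_of_pos (by simp only []; linarith), posPow_of_nonpos (x := z - r) (by linarith),
        Real.rpow_zero]
      ring
  · intro s hs
    rcases le_or_gt s A with h | h
    · rw [leftFrac, setIntegral_eq_zero_of_forall_eq_zero, zero_mul]
      intro r hr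
      rw [posPow_of_nonpos (by linarith [hr.1]), mul_zero]
    · have h' : B < s := by by_contra hc; exact hs ⟨h, not_lt.1 hc⟩
      rw [rightFrac, setIntegral_eq_zero_of_forall_eq_zero, mul_zero]
      intro r hr
      rw [posPow_of_nonpos (by linarith [hr.2]), posPow_of_nonpos (by linarith), sub_zero, mul_zero]

end Energy

section LeftFrac

variable {γ A B : ℝ} {φ : ℝ → ℝ}

lemma ae_integrable_leftFrac (hγ : -1 < γ) (hφ : IntegrableOn φ (Set.Ioc A B)) :
    (∀ᵐ s ∂volume.restrict (Set.Ioc A B),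
      IntegrableOn (fun r => φ r * posPow γ (s - r)) (Set.Ioc A B)) ∧
    IntegrableOn (leftFrac γ A B φ) (Set.Ioc A B) := by
  have h := integrable_weighted_kernel (μ := volume.restrict (Set.Ioc A B)) hφ
    (k := fun r s => posPow γ (s - r)) (by simp only [Function.uncurry_def]; fun_prop)
    (C := posPow (γ + 1) (B - A) / (γ + 1))
    ((ae_restrict_mem measurableSet_Ioc).mono fun r hr => by
      refine ⟨(integrableOn_posPow_sub hγ r B).mono_set Set.Ioc_subset_Iic_self, ?_⟩
      simp only [abs_of_nonneg (posPow_nonneg γ _)]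
      have hγ' : 0 < γ + 1 := by linarith
      calc _ ≤ ∫ s in Set.Iic B, posPow γ (s - r) :=
            setIntegral_mono_set (integrableOn_posPow_sub hγ r B)
              (Filter.Eventually.of_forall fun s => posPow_nonneg _ _)
              Set.Ioc_subset_Iic_self.eventuallyLE
        _ ≤ _ := by
            rw [setIntegral_posPow_sub hγ]
            gcongr
            exact posPow_mono hγ'.le (by linarith [hr.1]))
  exact ⟨h.prod_left_ae, h.integral_prod_right⟩

lemma leftFrac_eq_intervalIntegral {s : ℝ} (hs : s ∈ Set.Ioc A B) :
    leftFrac γ A B φ s = ∫ r in A..s, (s - r) ^ γ * φ r := by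
  rw [leftFrac, intervalIntegral.integral_of_le hs.1.le,
    setIntegral_eq_of_subset_of_forall_sdiff_eq_zero (s := Set.Ioo A s) measurableSet_Ioc
      (fun r hr => ⟨hr.1, hr.2.le.trans hs.2⟩) fun r hr => ?_, ← integral_Ioc_eq_integral_Ioo]
  · rw [integral_Ioc_eq_integral_Ioo, integral_Ioc_eq_integral_Ioo]
    refine setIntegral_congr_fun measurableSet_Ioo fun r hr => ?_
    simp only [posPow_of_pos (sub_pos.2 hr.2), mul_comm]
  · rw [posPow_of_nonpos (by by_contra hc; exact hr.2 ⟨hr.1.1, by linarith⟩), mul_zero]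

lemma leftFrac_zero_eq {u : ℝ → ℝ} (hφ : Continuous φ) (hu : ∀ s, HasDerivAt u (φ s) s)
    (huA : u A = 0) {s : ℝ} (hs : s ∈ Set.Ioc A B) : leftFrac 0 A B φ s = u s := by
  rw [leftFrac_eq_intervalIntegral hs]
  simp only [Real.rpow_zero, one_mul]
  rw [intervalIntegral.integral_eq_sub_of_hasDerivAt (fun x _ => hu x)
    (hφ.intervalIntegrable _ _), huA, sub_zero]

lemma leftFrac_eq_integral_indicator (τ : ℝ) :
    leftFrac γ A B φ τ = ∫ x, posPow γ x * (Set.Ioc A B).indicator φ (τ - x) := by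
  rw [leftFrac, ← integral_indicator measurableSet_Ioc,
    ← integral_sub_left_eq_self (fun x => posPow γ x * _) volume τ]
  congr 1; ext r
  simp only [sub_sub_cancel, Set.indicator_apply]
  split_ifs <;> ring

/-- Differentiation of a fractional integral of a function vanishing at the left endpoint. -/
lemma hasDerivAt_leftFrac (hγ : -1 < γ) {u : ℝ → ℝ} (hφ : Continuous φ)
    (hu : ∀ s, HasDerivAt u (φ s) s) (huA : u A = 0) {s : ℝ} (hs : s ∈ Set.Ioo A B) :
    HasDerivAt (leftFrac γ A B u) (leftFrac γ A B φ s) s := by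
  obtain ⟨M, hM⟩ := isCompact_Icc.exists_bound_of_continuousOn (hφ.continuousOn (s := Set.Icc A B))
  have hM0 : 0 ≤ M := (norm_nonneg _).trans (hM s ⟨hs.1.le, hs.2.le⟩)
  have huc : Continuous u := continuous_iff_continuousAt.2 fun x => (hu x).continuousAt
  have hlip : ∀ x ∈ Set.Icc A B, ∀ y ∈ Set.Icc A B, ‖u y - u x‖ ≤ M * ‖y - x‖ := fun x hx y hy =>
    (convex_Icc A B).norm_image_sub_le_of_norm_hasDerivWithin_le
      (fun z _ => (hu z).hasDerivWithinAt) hM hx hy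
  set F : ℝ → ℝ → ℝ := fun τ x => posPow γ x * u (max A (τ - x)) with hF
  have hFae : ∀ τ, AEStronglyMeasurable (F τ) (volume.restrict (Set.Iic (B - A))) := fun τ => by
    have : Continuous fun x => u (max A (τ - x)) := by fun_prop
    exact ((measurable_posPow γ).mul this.measurable).aestronglyMeasurable
  have hpos := integrableOn_posPow_Iic hγ (B - A)
  have hbase : ∀ τ ∈ Set.Ioo A B, leftFrac γ A B u τ = ∫ x in Set.Iic (B - A), F τ x := by
    intro τ hτ
    rw [leftFrac_eq_integral_indicator, setIntegral_eq_integral_of_forall_compl_eq_zero]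
    · congr 1; ext x
      simp only [hF]
      rcases le_or_gt x 0 with hx | hx
      · simp [posPow_of_nonpos hx]
      · rcases le_or_gt (τ - x) A with h | h
        · rw [max_eq_left h, huA, Set.indicator_of_notMem fun h' => absurd h'.1 h.not_gt]
        · rw [max_eq_right h.le,
            Set.indicator_of_mem (show τ - x ∈ Set.Ioc A B from ⟨h, by linarith [hτ.2]⟩)]
    · intro x hx
      have : B - A < x := not_le.1 hx
      simp only [hF]
      rw [max_eq_left (by linarith [hτ.2]), huA, mul_zero]
  have hder : leftFrac γ A B φ s =
      ∫ x in Set.Iic (B - A), posPow γ x * (Set.Ioc A B).indicator φ (s - x) := by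
    rw [leftFrac_eq_integral_indicator, setIntegral_eq_integral_of_forall_compl_eq_zero]
    intro x hx
    have : B - A < x := not_le.1 hx
    rw [Set.indicator_of_notMem fun h' => absurd h'.1 (by linarith [hs.2]), mul_zero]
  rw [hder]
  have hFlip : ∀ x, ∀ τ ∈ Set.Ioo A B, ∀ τ' ∈ Set.Ioo A B,
      ‖F τ x - F τ' x‖ ≤ posPow γ x * M * ‖τ - τ'‖ := by
    intro x τ hτ τ' hτ'
    rcases le_or_gt x 0 with hx | hx
    · simp [hF, posPow_of_nonpos hx]
    · simp only [hF, ← mul_sub, norm_mul, Real.norm_of_nonneg (posPow_nonneg γ x), mul_assoc]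
      refine mul_le_mul_of_nonneg_left ?_ (posPow_nonneg γ x)
      have hAB : A < B := hs.1.trans hs.2
      refine (hlip (max A (τ' - x)) ⟨le_max_left _ _, max_le hAB.le (by linarith [hτ'.2])⟩
        (max A (τ - x)) ⟨le_max_left _ _, max_le hAB.le (by linarith [hτ.2])⟩).trans ?_
      refine mul_le_mul_of_nonneg_left ?_ hM0
      simp only [Real.norm_eq_abs]
      rw [max_comm A (τ - x), max_comm A (τ' - x)]
      refine (abs_max_sub_max_le_abs (τ - x) (τ' - x) A).trans_eq ?_
      congr 1; ring
  refine HasDerivAt.congr_of_eventuallyEq (f := fun τ => ∫ x in Set.Iic (B - A), F τ x) ?_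
    (Filter.eventually_of_mem (isOpen_Ioo.mem_nhds hs) hbase)
  refine (hasDerivAt_integral_of_dominated_loc_of_lip (isOpen_Ioo.mem_nhds hs)
    (Filter.Eventually.of_forall hFae) ?_ ?_ (bound := fun x => posPow γ x * M)
    (Filter.Eventually.of_forall fun x => ?_) (hpos.mul_const M) ?_).2
  · obtain ⟨D, hD⟩ := isCompact_Icc.exists_bound_of_continuousOn
      (huc.continuousOn (s := Set.Icc A B))
    refine (hpos.mul_const D).mono' (hFae s) (Filter.Eventually.of_forall fun x => ?_)
    rcases le_or_gt x 0 with hx | hx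
    · simp [hF, posPow_of_nonpos hx]
    · simp only [hF, norm_mul, Real.norm_of_nonneg (posPow_nonneg γ x)]
      exact mul_le_mul_of_nonneg_left (hD _ ⟨le_max_left _ _, max_le (hs.1.trans hs.2).le
        (by linarith [hs.2])⟩) (posPow_nonneg γ x)
  · have : Measurable ((Set.Ioc A B).indicator φ) := hφ.measurable.indicator measurableSet_Ioc
    exact ((measurable_posPow γ).mul
      (this.comp (measurable_const.sub measurable_id))).aestronglyMeasurable
  · refine LipschitzOnWith.of_dist_le_mul fun τ hτ τ' hτ' => ?_
    rw [dist_eq_norm, dist_eq_norm, Real.coe_nnabs,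
      abs_of_nonneg (mul_nonneg (posPow_nonneg γ x) hM0)]
    exact hFlip x τ hτ τ' hτ'
  · have hne : ∀ᵐ x ∂volume.restrict (Set.Iic (B - A)), x ≠ s - A :=
      ae_restrict_of_ae (Measure.ae_ne volume _)
    refine hne.mono fun x hx => ?_
    rcases le_or_gt x 0 with hx0 | hx0
    · simpa [hF, posPow_of_nonpos hx0] using hasDerivAt_const s (0 : ℝ)
    · refine HasDerivAt.const_mul _ ?_
      rcases lt_or_gt_of_ne hx with h | h
      · rw [Set.indicator_of_mem (show s - x ∈ Set.Ioc A B from ⟨by linarith, by linarith [hs.2]⟩)]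
        refine ((hu (s - x)).comp_sub_const s x).congr_of_eventuallyEq ?_
        filter_upwards [lt_mem_nhds (show A + x < s by linarith)] with τ hτ
        rw [max_eq_right (by linarith)]
      · rw [Set.indicator_of_notMem fun h' => absurd h'.1 (by linarith)]
        refine (hasDerivAt_const s (0 : ℝ)).congr_of_eventuallyEq ?_
        filter_upwards [gt_mem_nhds (show s < A + x by linarith)] with τ hτ
        rw [max_eq_left (by linarith), huA]

end LeftFrac

/-- The energy estimate for the Galerkin equation in the variable `s = ψ t`. -/
lemma energy_estimate {β : ℝ} (hβ : 0 < β) (hβ' : β < 1 / 2) {A B κ L : ℝ} (hκ : 0 < κ)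
    {f φ : ℝ → ℝ} (hf : IntegrableOn f (Set.Ioc A B)) (hφ : IntegrableOn φ (Set.Ioc A B))
    (hg : IntegrableOn (fun s => leftFrac (β - 1) A B f s ^ 2) (Set.Ioc A B))
    (h : κ * (∫ s in Set.Ioc A B, leftFrac (-(2 * β)) A B φ s * leftFrac 0 A B φ s) + L =
      ∫ s in Set.Ioc A B, f s * leftFrac 0 A B φ s) :
    L ≤ (∫ x, incrSq β x) * (1 - 2 * β) / (4 * κ * betaConst β ^ 2) *
      ∫ s in Set.Ioc A B, leftFrac (β - 1) A B f s ^ 2 := by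
  obtain ⟨hi, he⟩ := integral_rightFrac_sq hβ hβ' hφ
  obtain ⟨hj, hd⟩ := integral_leftFrac_mul_rightFrac hβ hβ' hf hφ
  have hc := integral_incrSq_pos hβ hβ'
  have hb := betaConst_pos hβ (by linarith)
  have hα : 0 < 1 - 2 * β := by linarith
  set c := ∫ x, incrSq β x
  set b := betaConst β
  set Z := ∫ s in Set.Ioc A B, leftFrac (-(2 * β)) A B φ s * leftFrac 0 A B φ s
  set ε := κ / (c * (1 - 2 * β)) with hε
  have hε0 : 0 < ε := by positivity
  have h1 : ∫ s in Set.Ioc A B, rightFrac β A B φ s ^ 2 ≤ c * (1 - 2 * β) * Z := by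
    rw [← he]
    exact setIntegral_le_integral hi (Filter.Eventually.of_forall fun s => sq_nonneg _)
  have h2 : ∫ s in Set.Ioc A B, -(b⁻¹) * (leftFrac (β - 1) A B f s * rightFrac β A B φ s) ≤
      ∫ s in Set.Ioc A B, ((4 * ε * b ^ 2)⁻¹ * leftFrac (β - 1) A B f s ^ 2 +
        ε * rightFrac β A B φ s ^ 2) := by
    refine integral_mono (hj.integrableOn.const_mul _)
      ((hg.const_mul _).add (hi.integrableOn.const_mul _)) fun s => ?_
    simp only []
    rw [← sub_nonneg]
    have : (4 * ε * b ^ 2)⁻¹ * leftFrac (β - 1) A B f s ^ 2 + ε * rightFrac β A B φ s ^ 2 -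
        -(b⁻¹) * (leftFrac (β - 1) A B f s * rightFrac β A B φ s) =
        (4 * ε * b ^ 2)⁻¹ *
          (leftFrac (β - 1) A B f s + 2 * ε * b * rightFrac β A B φ s) ^ 2 := by
      field_simp
      ring
    rw [this]
    positivity
  rw [integral_const_mul, hd, integral_add (hg.const_mul _) (hi.integrableOn.const_mul _),
    integral_const_mul, integral_const_mul, neg_mul, neg_mul, mul_neg, neg_neg,
    inv_mul_cancel_left₀ hb.ne', ← h] at h2
  have h3 : ε * ∫ s in Set.Ioc A B, rightFrac β A B φ s ^ 2 ≤ κ * Z := by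
    refine (mul_le_mul_of_nonneg_left h1 hε0.le).trans_eq ?_
    rw [hε]; field_simp
  have h4 : (4 * ε * b ^ 2)⁻¹ = c * (1 - 2 * β) / (4 * κ * b ^ 2) := by
    rw [hε]; field_simp
  rw [h4] at h2
  linarith

lemma fractional_energy_nonneg {β : ℝ} (hβ : 0 < β) (hβ' : β < 1 / 2) {A B : ℝ}
    {φ : ℝ → ℝ} (hφ : IntegrableOn φ (Set.Ioc A B)) :
    0 ≤ ∫ s in Set.Ioc A B, leftFrac (-(2 * β)) A B φ s * leftFrac 0 A B φ s := by
  obtain ⟨-, he⟩ := integral_rightFrac_sq hβ hβ' hφ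
  have hc := integral_incrSq_pos hβ hβ'
  refine nonneg_of_mul_nonneg_right ?_
    (mul_pos hc (show 0 < 1 - 2 * β by linarith))
  rw [← he]
  exact integral_nonneg fun s => sq_nonneg _

section ChangeOfVariables

variable {ψ χ : ℝ → ℝ} {a b : ℝ}

lemma image_Ioc_of_strictMono (hmono : StrictMono ψ) (hχ : Function.RightInverse χ ψ) (a b : ℝ) :
    ψ '' Set.Ioc a b = Set.Ioc (ψ a) (ψ b) := by
  ext s
  constructor
  · rintro ⟨t, ht, rfl⟩
    exact ⟨hmono ht.1, hmono.monotone ht.2⟩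
  · intro hs
    rw [← hχ s] at hs
    exact ⟨χ s, ⟨hmono.lt_iff_lt.1 hs.1, hmono.le_iff_le.1 hs.2⟩, hχ s⟩

lemma setIntegral_comp_mul_deriv (hd : Differentiable ℝ ψ) (hψ' : ∀ t, 0 < deriv ψ t)
    (hmono : StrictMono ψ) (hχ : Function.RightInverse χ ψ) (F : ℝ → ℝ) :
    ∫ t in Set.Ioc a b, F (ψ t) * deriv ψ t = ∫ s in Set.Ioc (ψ a) (ψ b), F s := by
  rw [← image_Ioc_of_strictMono hmono hχ, integral_image_eq_integral_abs_deriv_smul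
    measurableSet_Ioc (fun x _ => (hd x).hasDerivAt.hasDerivWithinAt) hmono.injective.injOn]
  simp only [abs_of_pos (hψ' _), smul_eq_mul, mul_comm]

lemma integrableOn_comp_mul_deriv (hd : Differentiable ℝ ψ) (hψ' : ∀ t, 0 < deriv ψ t)
    (hmono : StrictMono ψ) (hχ : Function.RightInverse χ ψ) (F : ℝ → ℝ) :
    IntegrableOn (fun t => F (ψ t) * deriv ψ t) (Set.Ioc a b) ↔
      IntegrableOn F (Set.Ioc (ψ a) (ψ b)) := by
  rw [← image_Ioc_of_strictMono hmono hχ, integrableOn_image_iff_integrableOn_abs_deriv_smul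
    measurableSet_Ioc (fun x _ => (hd x).hasDerivAt.hasDerivWithinAt) hmono.injective.injOn]
  simp only [abs_of_pos (hψ' _), smul_eq_mul, mul_comm]

lemma leftPsiI_eq_leftFrac (hd : Differentiable ℝ ψ) (hψ' : ∀ t, 0 < deriv ψ t)
    (hmono : StrictMono ψ) (hχ : Function.RightInverse χ ψ) (μ : ℝ) (v : ℝ → ℝ) {t : ℝ}
    (ht : t ∈ Set.Ioc a b) :
    leftPsiI ψ a μ v t =
      1 / Real.Gamma μ * leftFrac (μ - 1) (ψ a) (ψ b) (fun s => v (χ s)) (ψ t) := by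
  have hl : Function.LeftInverse χ ψ := fun x => hmono.injective (hχ (ψ x))
  rw [leftPsiI, leftFrac_eq_intervalIntegral ⟨hmono ht.1, hmono.monotone ht.2⟩,
    intervalIntegral.integral_of_le ht.1.le,
    intervalIntegral.integral_of_le (hmono.monotone ht.1.le),
    ← setIntegral_comp_mul_deriv hd hψ' hmono hχ]
  congr 2; ext z
  rw [hl z]; ring

lemma leftPsiD_eq_leftFrac (hd : Differentiable ℝ ψ) (hψ' : ∀ t, 0 < deriv ψ t)
    (hmono : StrictMono ψ) (hχ : Function.RightInverse χ ψ) {δ : ℝ} (hδ : δ < 1) {v φ : ℝ → ℝ}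
    (hφ : Continuous φ) (hv : ∀ s, HasDerivAt (fun s => v (χ s)) (φ s) s) (hva : v a = 0) {t : ℝ}
    (ht : t ∈ Set.Ioo a b) :
    leftPsiD ψ a δ v t = 1 / Real.Gamma (1 - δ) * leftFrac (-δ) (ψ a) (ψ b) φ (ψ t) := by
  have hl : Function.LeftInverse χ ψ := fun x => hmono.injective (hχ (ψ x))
  have h1 : HasDerivAt (fun τ => leftPsiI ψ a (1 - δ) v τ)
      (1 / Real.Gamma (1 - δ) * (leftFrac (-δ) (ψ a) (ψ b) φ (ψ t) * deriv ψ t)) t := by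
    refine HasDerivAt.congr_of_eventuallyEq (HasDerivAt.const_mul _
      ((hasDerivAt_leftFrac (γ := -δ) (by linarith) hφ hv (by simp only [hl a, hva])
        ⟨hmono ht.1, hmono ht.2⟩).comp t (hd t).hasDerivAt)) ?_
    refine Filter.eventually_of_mem (isOpen_Ioo.mem_nhds ht) fun τ hτ => ?_
    simpa [sub_sub_cancel_left] using
      leftPsiI_eq_leftFrac hd hψ' hmono hχ (1 - δ) v (Set.Ioo_subset_Ioc_self hτ)
  rw [leftPsiD, h1.deriv]
  field_simp [(hψ' t).ne']

lemma hasDerivAt_rightInverse (hψ : ContDiff ℝ 1 ψ) (hψ' : ∀ t, 0 < deriv ψ t)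
    (hmono : StrictMono ψ) (hχ : Function.RightInverse χ ψ) (s : ℝ) :
    HasDerivAt χ (deriv ψ (χ s))⁻¹ s := by
  have hm : Monotone χ := fun x y hxy => by rwa [← hmono.le_iff_le, hχ x, hχ y]
  have hl : Function.LeftInverse χ ψ := fun x => hmono.injective (hχ (ψ x))
  have hc : Continuous χ := hm.continuous_of_surjective hl.surjective
  exact HasDerivAt.of_local_left_inverse hc.continuousAt
    (hψ.differentiable one_ne_zero _).hasDerivAt (hψ' _).ne'
    (Filter.Eventually.of_forall fun x => hχ x)

end ChangeOfVariables

/-- A bilinear form that is definite on a finite-dimensional subspace represents every linear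
functional on it by exactly one vector. -/
lemma existsUnique_galerkin {E : Type*} [AddCommGroup E] [Module ℝ E] (V : Submodule ℝ E)
    [FiniteDimensional ℝ V] (G : E →ₗ[ℝ] E →ₗ[ℝ] ℝ) (F : E →ₗ[ℝ] ℝ)
    (hG : ∀ v ∈ V, G v v = 0 → v = 0) : ∃! v : E, v ∈ V ∧ ∀ w ∈ V, G v w = F w := by
  have hinj : Function.Injective (G.domRestrict₁₂ V V) := by
    refine (injective_iff_map_eq_zero _).2 fun v hv => ?_
    have : G v v = 0 := LinearMap.congr_fun hv v
    exact Subtype.ext (hG v v.2 this)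
  have hsurj := (LinearMap.injective_iff_surjective_of_finrank_eq_finrank
    (Subspace.dual_finrank_eq (K := ℝ) (V := V)).symm).1 hinj
  obtain ⟨v, hv⟩ := hsurj (F.domRestrict V)
  refine ⟨v, ⟨v.2, fun w hw => LinearMap.congr_fun hv ⟨w, hw⟩⟩, ?_⟩
  rintro y ⟨hy, hy'⟩
  have : (⟨y, hy⟩ : V) = v := by
    refine hinj (LinearMap.ext fun w => ?_)
    rw [hv]
    exact hy' w w.2
  rw [← this]

/-- Polynomials of degree at most `N` vanishing at `a`. -/
noncomputable def polyVN (a : ℝ) (N : ℕ) : Submodule ℝ (Polynomial ℝ) :=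
  Polynomial.degreeLE ℝ N ⊓ LinearMap.ker (Polynomial.leval a)

lemma mem_polyVN {a : ℝ} {N : ℕ} {q : Polynomial ℝ} :
    q ∈ polyVN a N ↔ q.natDegree ≤ N ∧ q.eval a = 0 := by
  simp [polyVN, Polynomial.mem_degreeLE, Polynomial.natDegree_le_iff_degree_le,
    Polynomial.leval_apply]

instance (a : ℝ) (N : ℕ) : FiniteDimensional ℝ (polyVN a N) := by
  have : FiniteDimensional ℝ (Polynomial.degreeLE ℝ N) := by
    rw [← Polynomial.degreeLT_succ_eq_degreeLE]
    exact Module.Finite.equiv (Polynomial.degreeLTEquiv ℝ N.succ).symm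
  exact Submodule.finiteDimensional_of_le inf_le_left

/-- The bilinear form `(v, w) ↦ ∫ h v * w ∘ χ` for `h` linear up to null sets. -/
noncomputable def pairingForm (m : Measure ℝ) (χ : ℝ → ℝ) (h : Polynomial ℝ → ℝ → ℝ)
    (hadd : ∀ p q, h (p + q) =ᵐ[m] h p + h q) (hsmul : ∀ (c : ℝ) q, h (c • q) =ᵐ[m] c • h q)
    (hprod : ∀ p q : Polynomial ℝ, Integrable (fun s => h p s * q.eval (χ s)) m) :
    Polynomial ℝ →ₗ[ℝ] Polynomial ℝ →ₗ[ℝ] ℝ :=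
  LinearMap.mk₂ ℝ (fun p q => ∫ s, h p s * q.eval (χ s) ∂m)
    (fun p p' q => by
      rw [← integral_add (hprod p q) (hprod p' q)]
      refine integral_congr_ae ((hadd p p').mono fun s hs => ?_)
      simp only [hs, Pi.add_apply, add_mul])
    (fun c p q => by
      rw [smul_eq_mul, ← integral_const_mul]
      refine integral_congr_ae ((hsmul c p).mono fun s hs => ?_)
      simp only [hs, Pi.smul_apply, smul_eq_mul, mul_assoc])
    (fun p q q' => by
      rw [← integral_add (hprod p q) (hprod p q')]
      simp only [Polynomial.eval_add, mul_add])
    (fun c p q => by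
      rw [smul_eq_mul, ← integral_const_mul]
      simp only [Polynomial.eval_smul, smul_eq_mul, mul_left_comm])

lemma leftFrac_add_ae {γ A B : ℝ} (hγ : -1 < γ) {φ φ' : ℝ → ℝ}
    (hφ : IntegrableOn φ (Set.Ioc A B)) (hφ' : IntegrableOn φ' (Set.Ioc A B)) :
    leftFrac γ A B (fun s => φ s + φ' s) =ᵐ[volume.restrict (Set.Ioc A B)]
      fun s => leftFrac γ A B φ s + leftFrac γ A B φ' s := by
  filter_upwards [(ae_integrable_leftFrac hγ hφ).1, (ae_integrable_leftFrac hγ hφ').1] with s h h'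
  simp only [leftFrac, add_mul]
  exact integral_add h h'

lemma leftFrac_const_mul (γ A B c : ℝ) (φ : ℝ → ℝ) (s : ℝ) :
    leftFrac γ A B (fun s => c * φ s) s = c * leftFrac γ A B φ s := by
  simp only [leftFrac, mul_assoc, integral_const_mul]

/-- The derivative of `q ∘ χ`, where `χ` is the inverse of `ψ`. -/
noncomputable def pullDeriv (ψ χ : ℝ → ℝ) (q : Polynomial ℝ) (s : ℝ) : ℝ :=
  q.derivative.eval (χ s) * (deriv ψ (χ s))⁻¹

section Galerkin

variable {ψ χ : ℝ → ℝ} {a b δ : ℝ}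

lemma continuous_pullDeriv (hψ : ContDiff ℝ 1 ψ) (hψ' : ∀ t, 0 < deriv ψ t)
    (hc : Continuous χ) (q : Polynomial ℝ) : Continuous (pullDeriv ψ χ q) := by
  have h1 : Continuous (deriv ψ) := hψ.continuous_deriv le_rfl
  exact (q.derivative.continuous.comp hc).mul ((h1.comp hc).inv₀ fun s => (hψ' _).ne')

lemma hasDerivAt_eval_comp (hχ' : ∀ s, HasDerivAt χ (deriv ψ (χ s))⁻¹ s) (q : Polynomial ℝ)
    (s : ℝ) : HasDerivAt (fun s => q.eval (χ s)) (pullDeriv ψ χ q s) s :=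
  (q.hasDerivAt (χ s)).comp s (hχ' s)

/-- The density, in the variable `s = ψ t`, of `D^δ q + λ q`. -/
noncomputable def galerkinDensity (ψ χ : ℝ → ℝ) (a b δ lam : ℝ) (q : Polynomial ℝ) (s : ℝ) : ℝ :=
  1 / Real.Gamma (1 - δ) * leftFrac (-δ) (ψ a) (ψ b) (pullDeriv ψ χ q) s + lam * q.eval (χ s)

lemma integrableOn_mul_eval {A B : ℝ} (hc : Continuous χ) {g : ℝ → ℝ}
    (hg : IntegrableOn g (Set.Ioc A B)) (q : Polynomial ℝ) :
    IntegrableOn (fun s => g s * q.eval (χ s)) (Set.Ioc A B) := by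
  rw [← integrableOn_Icc_iff_integrableOn_Ioc] at hg ⊢
  exact hg.mul_continuousOn (q.continuous.comp hc).continuousOn isCompact_Icc

lemma integrableOn_galerkinDensity (hψ : ContDiff ℝ 1 ψ) (hψ' : ∀ t, 0 < deriv ψ t)
    (hc : Continuous χ) (hδ : δ < 1) (lam : ℝ) (q : Polynomial ℝ) :
    IntegrableOn (galerkinDensity ψ χ a b δ lam q) (Set.Ioc (ψ a) (ψ b)) :=
  ((ae_integrable_leftFrac (by linarith)
    ((continuous_pullDeriv hψ hψ' hc q).integrableOn_Ioc)).2.const_mul _).add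
    (((q.continuous.comp hc).integrableOn_Ioc).const_mul _)

lemma galerkinDensity_add (hψ : ContDiff ℝ 1 ψ) (hψ' : ∀ t, 0 < deriv ψ t)
    (hc : Continuous χ) (hδ : δ < 1) (lam : ℝ) (p q : Polynomial ℝ) :
    galerkinDensity ψ χ a b δ lam (p + q) =ᵐ[volume.restrict (Set.Ioc (ψ a) (ψ b))]
      galerkinDensity ψ χ a b δ lam p + galerkinDensity ψ χ a b δ lam q := by
  have h : pullDeriv ψ χ (p + q) = fun s => pullDeriv ψ χ p s + pullDeriv ψ χ q s := by
    ext s; simp [pullDeriv, add_mul]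
  refine (leftFrac_add_ae (γ := -δ) (by linarith)
    (continuous_pullDeriv hψ hψ' hc p).integrableOn_Ioc
    (continuous_pullDeriv hψ hψ' hc q).integrableOn_Ioc).mono fun s hs => ?_
  simp only [galerkinDensity, Pi.add_apply, h, hs, Polynomial.eval_add]
  ring

lemma galerkinDensity_smul (lam c : ℝ) (q : Polynomial ℝ) :
    galerkinDensity ψ χ a b δ lam (c • q) = c • galerkinDensity ψ χ a b δ lam q := by
  have h : pullDeriv ψ χ (c • q) = fun s => c * pullDeriv ψ χ q s := by
    ext s; simp [pullDeriv, mul_assoc]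
  ext s
  simp only [galerkinDensity, Pi.smul_apply, h, leftFrac_const_mul, Polynomial.eval_smul,
    smul_eq_mul]
  ring

lemma intervalIntegral_mul_deriv (hd : Differentiable ℝ ψ) (hψ' : ∀ t, 0 < deriv ψ t)
    (hmono : StrictMono ψ) (hχ : Function.RightInverse χ ψ) (hab : a ≤ b) (v w : ℝ → ℝ) :
    ∫ t in a..b, v t * w t * deriv ψ t =
      ∫ s in Set.Ioc (ψ a) (ψ b), v (χ s) * w (χ s) := by
  have hl : Function.LeftInverse χ ψ := fun x => hmono.injective (hχ (ψ x))
  rw [intervalIntegral.integral_of_le hab, ← setIntegral_comp_mul_deriv hd hψ' hmono hχ]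
  simp only [hl _]

/-- The Galerkin bilinear form in the variable `s = ψ t`. -/
lemma galerkin_form_eq (hψ : ContDiff ℝ 1 ψ) (hψ' : ∀ t, 0 < deriv ψ t)
    (hmono : StrictMono ψ) (hχ : Function.RightInverse χ ψ)
    (hχ' : ∀ s, HasDerivAt χ (deriv ψ (χ s))⁻¹ s) (hδ : δ < 1) (hab : a ≤ b) (lam : ℝ)
    {q : Polynomial ℝ} (hq : q.eval a = 0) (w : Polynomial ℝ) :
    (∫ t in a..b, leftPsiD ψ a δ (fun t => q.eval t) t * w.eval t * deriv ψ t) +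
        lam * ∫ t in a..b, q.eval t * w.eval t * deriv ψ t =
      ∫ s in Set.Ioc (ψ a) (ψ b), galerkinDensity ψ χ a b δ lam q s * w.eval (χ s) := by
  have hd := hψ.differentiable one_ne_zero
  have hc : Continuous χ := continuous_iff_continuousAt.2 fun x => (hχ' x).continuousAt
  have hl : Function.LeftInverse χ ψ := fun x => hmono.injective (hχ (ψ x))
  have h1 : ∫ t in a..b, leftPsiD ψ a δ (fun t => q.eval t) t * w.eval t * deriv ψ t =
      ∫ s in Set.Ioc (ψ a) (ψ b), 1 / Real.Gamma (1 - δ) *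
        leftFrac (-δ) (ψ a) (ψ b) (pullDeriv ψ χ q) s * w.eval (χ s) := by
    rw [intervalIntegral.integral_of_le hab, ← setIntegral_comp_mul_deriv hd hψ' hmono hχ,
      integral_Ioc_eq_integral_Ioo, integral_Ioc_eq_integral_Ioo]
    refine setIntegral_congr_fun measurableSet_Ioo fun t ht => ?_
    simp only [hl t]
    rw [leftPsiD_eq_leftFrac hd hψ' hmono hχ hδ (continuous_pullDeriv hψ hψ' hc q)
      (hasDerivAt_eval_comp hχ' q) hq ht]
  rw [h1, intervalIntegral_mul_deriv hd hψ' hmono hχ hab, ← integral_const_mul, ← integral_add]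
  · simp only [galerkinDensity, add_mul, mul_assoc]
  · exact integrableOn_mul_eval hc ((ae_integrable_leftFrac (by linarith)
      (continuous_pullDeriv hψ hψ' hc q).integrableOn_Ioc).2.const_mul _) w
  · exact (integrableOn_mul_eval hc (q.continuous.comp hc).integrableOn_Ioc w).const_mul _

/-- The Galerkin form on the diagonal. -/
lemma galerkin_form_self (hψ : ContDiff ℝ 1 ψ) (hψ' : ∀ t, 0 < deriv ψ t)
    (hmono : StrictMono ψ) (hχ : Function.RightInverse χ ψ)
    (hχ' : ∀ s, HasDerivAt χ (deriv ψ (χ s))⁻¹ s) (hδ : δ < 1) (lam : ℝ)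
    {q : Polynomial ℝ} (hq : q.eval a = 0) :
    ∫ s in Set.Ioc (ψ a) (ψ b), galerkinDensity ψ χ a b δ lam q s * q.eval (χ s) =
      1 / Real.Gamma (1 - δ) * (∫ s in Set.Ioc (ψ a) (ψ b),
        leftFrac (-δ) (ψ a) (ψ b) (pullDeriv ψ χ q) s *
          leftFrac 0 (ψ a) (ψ b) (pullDeriv ψ χ q) s) +
      lam * ∫ s in Set.Ioc (ψ a) (ψ b), q.eval (χ s) ^ 2 := by
  have hc : Continuous χ := continuous_iff_continuousAt.2 fun x => (hχ' x).continuousAt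
  have hl : Function.LeftInverse χ ψ := fun x => hmono.injective (hχ (ψ x))
  have hi := integrableOn_mul_eval hc (ae_integrable_leftFrac (γ := -δ) (by linarith)
      ((continuous_pullDeriv hψ hψ' hc q).integrableOn_Ioc (a := ψ a) (b := ψ b))).2 q
  have h0 : ∫ s in Set.Ioc (ψ a) (ψ b), leftFrac (-δ) (ψ a) (ψ b) (pullDeriv ψ χ q) s *
          leftFrac 0 (ψ a) (ψ b) (pullDeriv ψ χ q) s =
      ∫ s in Set.Ioc (ψ a) (ψ b), leftFrac (-δ) (ψ a) (ψ b) (pullDeriv ψ χ q) s *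
        q.eval (χ s) := by
    refine setIntegral_congr_fun measurableSet_Ioc fun s hs => ?_
    rw [leftFrac_zero_eq (continuous_pullDeriv hψ hψ' hc q) (hasDerivAt_eval_comp hχ' q)
      (by simp only [hl a, hq]) hs]
  have hi2 : IntegrableOn (fun s => q.eval (χ s) ^ 2) (Set.Ioc (ψ a) (ψ b)) :=
    ((q.continuous.comp hc).pow 2).integrableOn_Ioc
  rw [h0, ← integral_const_mul, ← integral_const_mul, ← integral_add (hi.const_mul _)
    (hi2.const_mul _)]
  congr 1; ext s
  simp only [galerkinDensity]
  ring

end Galerkin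

section Transfer

variable {ψ χ : ℝ → ℝ} {a b : ℝ}

lemma integrableOn_comp_of_sq (hψ : ContDiff ℝ 1 ψ) (hψ' : ∀ t, 0 < deriv ψ t)
    (hmono : StrictMono ψ) (hχ : Function.RightInverse χ ψ) {f : ℝ → ℝ}
    (hf : AEStronglyMeasurable f (volume.restrict (Set.Ioc a b)))
    (hf2 : IntegrableOn (fun t => f t ^ 2 * deriv ψ t) (Set.Ioc a b)) :
    IntegrableOn (fun s => f (χ s)) (Set.Ioc (ψ a) (ψ b)) := by
  have hl : Function.LeftInverse χ ψ := fun x => hmono.injective (hχ (ψ x))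
  have hc : Continuous (deriv ψ) := hψ.continuous_deriv le_rfl
  rw [← integrableOn_comp_mul_deriv (hψ.differentiable one_ne_zero) hψ' hmono hχ]
  simp only [hl _]
  refine (hf2.add hc.integrableOn_Ioc).mono' (hf.mul hc.aestronglyMeasurable)
    (Filter.Eventually.of_forall fun t => ?_)
  simp only [norm_mul, Real.norm_eq_abs, abs_of_pos (hψ' t), Pi.add_apply]
  nlinarith [hψ' t, sq_abs (f t), sq_nonneg (|f t| - 1), abs_nonneg (f t)]

lemma leftPsiI_sq_eq (hψ : ContDiff ℝ 1 ψ) (hψ' : ∀ t, 0 < deriv ψ t)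
    (hmono : StrictMono ψ) (hχ : Function.RightInverse χ ψ) (μ : ℝ) (f : ℝ → ℝ) :
    Set.EqOn (fun t => leftPsiI ψ a μ f t ^ 2 * deriv ψ t)
      (fun t => (fun s => (1 / Real.Gamma μ) ^ 2 *
        leftFrac (μ - 1) (ψ a) (ψ b) (fun s => f (χ s)) s ^ 2) (ψ t) * deriv ψ t)
      (Set.Ioc a b) := fun t ht => by
  simp only [leftPsiI_eq_leftFrac (hψ.differentiable one_ne_zero) hψ' hmono hχ μ f ht, mul_pow]

lemma integrableOn_leftFrac_sq (hψ : ContDiff ℝ 1 ψ) (hψ' : ∀ t, 0 < deriv ψ t)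
    (hmono : StrictMono ψ) (hχ : Function.RightInverse χ ψ) {μ : ℝ} (hμ : 0 < μ) {f : ℝ → ℝ}
    (hf : IntegrableOn (fun t => leftPsiI ψ a μ f t ^ 2 * deriv ψ t) (Set.Ioc a b)) :
    IntegrableOn (fun s => leftFrac (μ - 1) (ψ a) (ψ b) (fun s => f (χ s)) s ^ 2)
      (Set.Ioc (ψ a) (ψ b)) := by
  rw [integrableOn_congr_fun (leftPsiI_sq_eq hψ hψ' hmono hχ μ f) measurableSet_Ioc] at hf
  replace hf := (integrableOn_comp_mul_deriv (hψ.differentiable one_ne_zero) hψ' hmono hχ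
    fun s => (1 / Real.Gamma μ) ^ 2 *
      leftFrac (μ - 1) (ψ a) (ψ b) (fun s => f (χ s)) s ^ 2).1 hf
  have hΓ := (Real.Gamma_pos_of_pos hμ).ne'
  refine (hf.const_mul (Real.Gamma μ ^ 2)).congr (Filter.Eventually.of_forall fun s => ?_)
  field_simp

lemma psiNorm_leftPsiI (hψ : ContDiff ℝ 1 ψ) (hψ' : ∀ t, 0 < deriv ψ t)
    (hmono : StrictMono ψ) (hχ : Function.RightInverse χ ψ) (hab : a ≤ b) {μ : ℝ} (hμ : 0 < μ)
    (f : ℝ → ℝ) :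
    ∫ s in Set.Ioc (ψ a) (ψ b), leftFrac (μ - 1) (ψ a) (ψ b) (fun s => f (χ s)) s ^ 2 =
      Real.Gamma μ ^ 2 * psiNorm ψ a b (leftPsiI ψ a μ f) ^ 2 := by
  have hΓ := (Real.Gamma_pos_of_pos hμ).ne'
  rw [psiNorm, Real.sq_sqrt (intervalIntegral.integral_nonneg hab
      fun t _ => mul_nonneg (sq_nonneg _) (hψ' t).le), intervalIntegral.integral_of_le hab,
    setIntegral_congr_fun measurableSet_Ioc (leftPsiI_sq_eq hψ hψ' hmono hχ μ f),
    setIntegral_comp_mul_deriv (hψ.differentiable one_ne_zero) hψ' hmono hχ fun s =>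
      (1 / Real.Gamma μ) ^ 2 * leftFrac (μ - 1) (ψ a) (ψ b) (fun s => f (χ s)) s ^ 2,
    integral_const_mul]
  field_simp

lemma psiNorm_nonneg (ψ : ℝ → ℝ) (a b : ℝ) (v : ℝ → ℝ) : 0 ≤ psiNorm ψ a b v :=
  Real.sqrt_nonneg _

lemma psiNorm_sq (hd : Differentiable ℝ ψ) (hψ' : ∀ t, 0 < deriv ψ t)
    (hmono : StrictMono ψ) (hχ : Function.RightInverse χ ψ) (hab : a ≤ b) (v : ℝ → ℝ) :
    psiNorm ψ a b v ^ 2 = ∫ s in Set.Ioc (ψ a) (ψ b), v (χ s) ^ 2 := by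
  rw [psiNorm, Real.sq_sqrt (intervalIntegral.integral_nonneg hab
      fun t _ => mul_nonneg (sq_nonneg _) (hψ' t).le)]
  simp only [sq]
  exact intervalIntegral_mul_deriv hd hψ' hmono hχ hab v v

lemma eq_zero_of_integral_eval_sq (hc : Continuous χ) (hl : Function.LeftInverse χ ψ)
    (hmono : StrictMono ψ) (hab : a < b) {q : Polynomial ℝ}
    (h : ∫ s in Set.Ioc (ψ a) (ψ b), q.eval (χ s) ^ 2 = 0) : q = 0 := by
  have hcont : Continuous fun s => q.eval (χ s) ^ 2 := (q.continuous.comp hc).pow 2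
  have h0 := (setIntegral_eq_zero_iff_of_nonneg_ae
    (Filter.Eventually.of_forall fun s => sq_nonneg _) hcont.integrableOn_Ioc).1 h
  have h1 := Measure.eqOn_Ioc_of_ae_eq volume h0 hcont.continuousOn continuousOn_const
  refine Polynomial.eq_zero_of_infinite_isRoot q ((Set.Ioc_infinite hab).mono fun t ht => ?_)
  have := h1 ⟨hmono ht.1, hmono.monotone ht.2⟩
  simpa [hl t] using this

end Transfer

/-- Well-posedness and stability of the Galerkin spectral approximation:
there is a unique `v_N ∈ V_N` with `A(v_N, w) = F(w)` for all `w ∈ V_N`, and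
`‖v_N‖_{L²_ψ} ≤ C ‖I^{δ/2,ψ}_t f‖_{L²_ψ}` with `C` independent of `N` and `f`. -/
theorem galerkin_spectral_well_posed
    (δ : ℝ) (hδ0 : 0 < δ) (hδ1 : δ < 1)
    (ψ : ℝ → ℝ) (hψ : ContDiff ℝ 1 ψ) (hmono : StrictMono ψ)
    (hbij : Function.Bijective ψ) (hψ' : ∀ t, 0 < deriv ψ t)
    (a b : ℝ) (hab : a < b)
    (lam : ℝ) (hlam : 0 < lam) :
    ∃ C : ℝ, 0 < C ∧ ∀ N : ℕ, 1 ≤ N → ∀ f : ℝ → ℝ,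
      AEStronglyMeasurable f (volume.restrict (Set.Ioc a b)) →
      IntegrableOn (fun t => (f t) ^ 2 * deriv ψ t) (Set.Ioc a b) →
      IntegrableOn (fun t => (leftPsiI ψ a (δ / 2) f t) ^ 2 * deriv ψ t) (Set.Ioc a b) →
      (∃! vN : ℝ → ℝ, memVN a N vN ∧ ∀ w : ℝ → ℝ, memVN a N w →
          (∫ t in a..b, leftPsiD ψ a δ vN t * w t * deriv ψ t)
              + lam * ∫ t in a..b, vN t * w t * deriv ψ t
            = ∫ t in a..b, f t * w t * deriv ψ t)
      ∧ (∀ vN : ℝ → ℝ, memVN a N vN →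
          (∀ w : ℝ → ℝ, memVN a N w →
            (∫ t in a..b, leftPsiD ψ a δ vN t * w t * deriv ψ t)
                + lam * ∫ t in a..b, vN t * w t * deriv ψ t
              = ∫ t in a..b, f t * w t * deriv ψ t) →
          psiNorm ψ a b vN ≤ C * psiNorm ψ a b (leftPsiI ψ a (δ / 2) f)) := by
  have hd := hψ.differentiable one_ne_zero
  obtain ⟨χ, hl, hχ⟩ := Function.bijective_iff_has_inverse.1 hbij
  have hχ' := hasDerivAt_rightInverse hψ hψ' hmono hχ
  have hc : Continuous χ := continuous_iff_continuousAt.2 fun x => (hχ' x).continuousAt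
  have hβ : 0 < δ / 2 := by linarith
  have hβ' : δ / 2 < 1 / 2 := by linarith
  have h2β : -(2 * (δ / 2)) = -δ := by ring
  have hκ : 0 < 1 / Real.Gamma (1 - δ) := one_div_pos.2 (Real.Gamma_pos_of_pos (by linarith))
  have hΓ := Real.Gamma_pos_of_pos hβ
  have hφ := fun q => (continuous_pullDeriv hψ hψ' hc q).integrableOn_Ioc (a := ψ a) (b := ψ b)
    (μ := volume)
  obtain ⟨K, hK⟩ : ∃ K, K = (∫ x, incrSq (δ / 2) x) * (1 - 2 * (δ / 2)) /
    (4 * (1 / Real.Gamma (1 - δ)) * betaConst (δ / 2) ^ 2) := ⟨_, rfl⟩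
  have hK0 : 0 < K := by
    rw [hK]
    have := integral_incrSq_pos hβ hβ'
    have := betaConst_pos hβ (by linarith)
    have : 0 < 1 - 2 * (δ / 2) := by linarith
    positivity
  refine ⟨√(K * Real.Gamma (δ / 2) ^ 2 / lam), by positivity, fun N _ f hf hf2 hIf => ?_⟩
  have hfi := integrableOn_comp_of_sq hψ hψ' hmono hχ hf hf2
  have hg := integrableOn_leftFrac_sq hψ hψ' hmono hχ hβ hIf
  set m := volume.restrict (Set.Ioc (ψ a) (ψ b)) with hm
  let G := pairingForm m χ (galerkinDensity ψ χ a b δ lam)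
    (galerkinDensity_add hψ hψ' hc hδ1 lam)
    (fun c q => Filter.EventuallyEq.of_eq (galerkinDensity_smul lam c q))
    (fun p q => integrableOn_mul_eval hc (integrableOn_galerkinDensity hψ hψ' hc hδ1 lam p) q)
  let F : Polynomial ℝ →ₗ[ℝ] ℝ :=
    { toFun := fun q => ∫ s, f (χ s) * q.eval (χ s) ∂m
      map_add' := fun p q => by
        rw [← integral_add (integrableOn_mul_eval hc hfi p) (integrableOn_mul_eval hc hfi q)]
        simp only [Polynomial.eval_add, mul_add, hm]
      map_smul' := fun c q => by
        rw [smul_eq_mul, ← integral_const_mul]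
        simp only [Polynomial.eval_smul, smul_eq_mul, mul_left_comm, RingHom.id_apply] }
  have hGF : ∀ q : Polynomial ℝ, q.eval a = 0 → ∀ w : Polynomial ℝ,
      ((∫ t in a..b, leftPsiD ψ a δ (fun t => q.eval t) t * w.eval t * deriv ψ t) +
        lam * (∫ t in a..b, q.eval t * w.eval t * deriv ψ t) =
        ∫ t in a..b, f t * w.eval t * deriv ψ t) ↔ G q w = F w := fun q hq w => by
    rw [galerkin_form_eq hψ hψ' hmono hχ hχ' hδ1 hab.le lam hq,
      intervalIntegral_mul_deriv hd hψ' hmono hχ hab.le f fun t => w.eval t]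
    rfl
  have hself := fun (q : Polynomial ℝ) (hq : q.eval a = 0) =>
    galerkin_form_self (b := b) hψ hψ' hmono hχ hχ' hδ1 lam hq
  have hdef : ∀ q ∈ polyVN a N, G q q = 0 → q = 0 := fun q hq h => by
    have hnn := mul_nonneg hκ.le (fractional_energy_nonneg hβ hβ' (hφ q))
    have h' := (hself q (mem_polyVN.1 hq).2).symm.trans h
    rw [h2β] at hnn
    have h2 : 0 ≤ ∫ s in Set.Ioc (ψ a) (ψ b), q.eval (χ s) ^ 2 :=
      integral_nonneg fun s => sq_nonneg _
    refine eq_zero_of_integral_eval_sq hc hl hmono hab (le_antisymm ?_ h2)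
    by_contra! hlt
    linarith [mul_pos hlam hlt]
  constructor
  · obtain ⟨q, ⟨hqV, hqe⟩, huniq⟩ := existsUnique_galerkin (polyVN a N) G F hdef
    obtain ⟨hqd, hqa⟩ := mem_polyVN.1 hqV
    refine ⟨fun t => q.eval t, ⟨⟨q, hqd, hqa, fun t => rfl⟩, ?_⟩, ?_⟩
    · rintro w ⟨p, hpd, hpa, hp⟩
      obtain rfl : w = fun t => p.eval t := funext hp
      exact (hGF q hqa p).2 (hqe p (mem_polyVN.2 ⟨hpd, hpa⟩))
    · rintro v ⟨⟨p, hpd, hpa, hp⟩, hv⟩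
      obtain rfl : v = fun t => p.eval t := funext hp
      rw [huniq p ⟨mem_polyVN.2 ⟨hpd, hpa⟩, fun w hw => (hGF p hpa w).1 (hv _
        ⟨w, (mem_polyVN.1 hw).1, (mem_polyVN.1 hw).2, fun t => rfl⟩)⟩]
  · rintro v ⟨q, hqd, hqa, hq⟩ hv
    obtain rfl : v = fun t => q.eval t := funext hq
    have h1 := (hGF q hqa q).1 (hv _ ⟨q, hqd, hqa, fun t => rfl⟩)
    have h2 := (hself q hqa).symm.trans h1
    have h3 : ∫ s in Set.Ioc (ψ a) (ψ b), f (χ s) * q.eval (χ s) =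
        ∫ s in Set.Ioc (ψ a) (ψ b),
          f (χ s) * leftFrac 0 (ψ a) (ψ b) (pullDeriv ψ χ q) s := by
      refine setIntegral_congr_fun measurableSet_Ioc fun s hs => ?_
      rw [leftFrac_zero_eq (continuous_pullDeriv hψ hψ' hc q) (hasDerivAt_eval_comp hχ' q)
        (by simp only [hl a, hqa]) hs]
    have h4 := energy_estimate hβ hβ' hκ hfi (hφ q) hg
      (L := lam * ∫ s in Set.Ioc (ψ a) (ψ b), q.eval (χ s) ^ 2)
      (by rw [h2β]; exact h2.trans h3)
    rw [psiNorm_leftPsiI hψ hψ' hmono hχ hab.le hβ,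
      ← hK, ← psiNorm_sq hd hψ' hmono hχ hab.le fun t => q.eval t] at h4
    refine (sq_le_sq₀ (psiNorm_nonneg _ _ _ _) (mul_nonneg (Real.sqrt_nonneg _)
      (psiNorm_nonneg _ _ _ _))).1 ?_
    rw [mul_pow, Real.sq_sqrt (by positivity), div_mul_eq_mul_div, le_div_iff₀ hlam]
    linarith
end
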